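/- Assume there exist β, h ≥ 0 and λ, ν ∈ ℝ with (β_n,h_n) = (β,h) + n^{−1}(λ,ν) + o(n^{−1}), and assume f_{β,h} has multiple global minimizers x, x′, … in Ω. If ε > 0 is smaller than the distance between any two global minimizers, then lim_{n→∞} μ_{β_n,h_n,n}(N/n ∈ B(x,ε)) = τ(x)/(τ(x) + τ(x′) + ⋯), where τ(y) = (1 − β·min_{1≤i≤q} y_i)^{(2−q)/2} · exp((λ/2) Σ_{i=1}^q y_i² + ν y_1) and the sum runs over all global minimizers of f_{β,h}. -/

import Mathlib

open Real Filter Finset Topology MeasureTheory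

/-- The simplex `Ω = {x ∈ ℝ^q : x_1 + ⋯ + x_q = 1, x_i ≥ 0}`. -/
def simplex (q : ℕ) : Set (Fin q → ℝ) := {x | (∀ i, 0 ≤ x i) ∧ ∑ i, x i = 1}

/-- The Curie–Weiss Potts free energy
`f_{β,h}(x) = ∑ x_i log x_i − (β/2) ∑ x_i² − h x_1` (with `0 log 0 = 0`). -/
noncomputable def freeEnergy (q : ℕ) [NeZero q] (β h : ℝ) (x : Fin q → ℝ) : ℝ :=
  ∑ i, x i * Real.log (x i) - β / 2 * ∑ i, x i ^ 2 - h * x 0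

/-- Boltzmann weight of a spin configuration `σ : Fin n → Fin q`:
`exp((β/n) ∑_{i<j} δ_{σ_i,σ_j} + h ∑_i δ_{σ_i,1})`. -/
noncomputable def cwWeight (q n : ℕ) [NeZero q] (β h : ℝ) (σ : Fin n → Fin q) : ℝ :=
  Real.exp (β / n *
      ∑ p ∈ Finset.univ.filter (fun p : Fin n × Fin n => p.1 < p.2),
        (if σ p.1 = σ p.2 then (1 : ℝ) else 0)
    + h * ∑ i, (if σ i = 0 then (1 : ℝ) else 0))

/-- The partition function `Z_{β,h,n}`. -/
noncomputable def cwZ (q n : ℕ) [NeZero q] (β h : ℝ) : ℝ :=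
  ∑ σ : Fin n → Fin q, cwWeight q n β h σ

/-- The empirical color count `N_k(σ) = #{i : σ_i = k}`. -/
def colorCount {q n : ℕ} (σ : Fin n → Fin q) (k : Fin q) : ℕ :=
  (Finset.univ.filter (fun i => σ i = k)).card

/-- Probability of an event under the Curie–Weiss Potts measure `μ_{β,h,n}`. -/
noncomputable def cwProb (q n : ℕ) [NeZero q] (β h : ℝ) (A : Set (Fin n → Fin q)) : ℝ :=
  (∑ σ : Fin n → Fin q, Set.indicator A (cwWeight q n β h) σ) / cwZ q n β h

/-- Expectation of an observable under the Curie–Weiss Potts measure `μ_{β,h,n}`. -/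
noncomputable def cwExp (q n : ℕ) [NeZero q] (β h : ℝ) (g : (Fin n → Fin q) → ℝ) : ℝ :=
  (∑ σ : Fin n → Fin q, cwWeight q n β h σ * g σ) / cwZ q n β h

/-- The weight `τ(y) = (1 − β min_i y_i)^{(2−q)/2} exp((λ/2) ∑ y_i² + ν y_1)`. -/
noncomputable def tauWeight (q : ℕ) [NeZero q] (β lam nu : ℝ) (y : Fin q → ℝ) : ℝ :=
  (1 - β * ⨅ i, y i) ^ (((2 : ℝ) - q) / 2) *
    Real.exp (lam / 2 * ∑ i, y i ^ 2 + nu * y 0)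

section LogSumExp

variable {ι : Type*} [Fintype ι]

/-- The log-sum-exp function. -/
noncomputable def logSumExp (v : ι → ℝ) : ℝ := Real.log (∑ k, Real.exp (v k))

/-- The softmax (Gibbs) probability vector. -/
noncomputable def softmax (v : ι → ℝ) (k : ι) : ℝ := Real.exp (v k) / ∑ j, Real.exp (v j)

variable [Nonempty ι]

lemma sum_exp_pos (v : ι → ℝ) : 0 < ∑ k, Real.exp (v k) :=
  Finset.sum_pos (fun _ _ => Real.exp_pos _) Finset.univ_nonempty

lemma softmax_pos (v : ι → ℝ) (k : ι) : 0 < softmax v k :=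
  div_pos (Real.exp_pos _) (sum_exp_pos v)

lemma sum_softmax (v : ι → ℝ) : ∑ k, softmax v k = 1 := by
  simp only [softmax, ← Finset.sum_div]
  exact div_self (sum_exp_pos v).ne'

lemma softmax_le_one (v : ι → ℝ) (k : ι) : softmax v k ≤ 1 := by
  rw [← sum_softmax v]
  exact Finset.single_le_sum (fun i _ => (softmax_pos v i).le) (Finset.mem_univ k)

lemma log_softmax (v : ι → ℝ) (k : ι) : Real.log (softmax v k) = v k - logSumExp v := by
  rw [softmax, Real.log_div (Real.exp_pos _).ne' (sum_exp_pos v).ne', Real.log_exp, logSumExp]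

lemma exp_logSumExp (v : ι → ℝ) : Real.exp (logSumExp v) = ∑ k, Real.exp (v k) :=
  Real.exp_log (sum_exp_pos v)

lemma continuous_logSumExp : Continuous (logSumExp : (ι → ℝ) → ℝ) := by
  unfold logSumExp
  exact Continuous.log (by fun_prop) fun v => (sum_exp_pos v).ne'

lemma continuous_softmax (k : ι) : Continuous fun v : ι → ℝ => softmax v k := by
  unfold softmax
  exact Continuous.div (by fun_prop) (by fun_prop) fun v => (sum_exp_pos v).ne'

lemma mul_log_div_le {x p : ℝ} (hx : 0 ≤ x) (hp : 0 < p) :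
    x * (Real.log p - Real.log x) ≤ p - x := by
  rcases hx.eq_or_lt with rfl | hx
  · simpa using hp.le
  · rw [← Real.log_div hp.ne' hx.ne']
    have := Real.log_le_sub_one_of_pos (div_pos hp hx)
    calc x * Real.log (p / x) ≤ x * (p / x - 1) := by gcongr
      _ = p - x := by field_simp

lemma eq_of_mul_log_div_eq {x p : ℝ} (hx : 0 ≤ x) (hp : 0 < p)
    (h : x * (Real.log p - Real.log x) = p - x) : x = p := by
  rcases hx.eq_or_lt with rfl | hx
  · simp at h; exact absurd h.symm hp.ne'
  · rw [← Real.log_div hp.ne' hx.ne'] at h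
    by_contra hne
    have := Real.log_lt_sub_one_of_pos (div_pos hp hx) (by
      rw [Ne, div_eq_one_iff_eq hx.ne']; exact fun e => hne e.symm)
    have h2 : x * Real.log (p / x) < x * (p / x - 1) := by gcongr
    have h3 : x * (p / x - 1) = p - x := by field_simp
    linarith

lemma gibbs_identity (v x : ι → ℝ) (hx1 : ∑ i, x i = 1) :
    ∑ i, x i * v i - ∑ i, x i * Real.log (x i) - logSumExp v =
      ∑ i, x i * (Real.log (softmax v i) - Real.log (x i)) := by
  have : logSumExp v = ∑ i, x i * logSumExp v := by rw [← Finset.sum_mul, hx1, one_mul]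
  rw [this, ← Finset.sum_sub_distrib, ← Finset.sum_sub_distrib]
  refine Finset.sum_congr rfl fun i _ => ?_
  rw [log_softmax]; ring

/-- Gibbs variational inequality. -/
lemma gibbs_le (v x : ι → ℝ) (hx : ∀ i, 0 ≤ x i) (hx1 : ∑ i, x i = 1) :
    ∑ i, x i * v i - ∑ i, x i * Real.log (x i) ≤ logSumExp v := by
  have h1 := gibbs_identity v x hx1
  have h2 : ∑ i, x i * (Real.log (softmax v i) - Real.log (x i)) ≤ ∑ i, (softmax v i - x i) :=
    Finset.sum_le_sum fun i _ => mul_log_div_le (hx i) (softmax_pos v i)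
  rw [Finset.sum_sub_distrib, sum_softmax, hx1] at h2
  linarith

lemma eq_softmax_of_gibbs_eq (v x : ι → ℝ) (hx : ∀ i, 0 ≤ x i) (hx1 : ∑ i, x i = 1)
    (h : logSumExp v ≤ ∑ i, x i * v i - ∑ i, x i * Real.log (x i)) : x = softmax v := by
  have h1 := gibbs_identity v x hx1
  have hle : ∀ i ∈ Finset.univ, x i * (Real.log (softmax v i) - Real.log (x i)) ≤
      softmax v i - x i := fun i _ => mul_log_div_le (hx i) (softmax_pos v i)
  have h2 := Finset.sum_le_sum hle
  have h3 : ∑ i, (softmax v i - x i) = 0 := by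
    rw [Finset.sum_sub_distrib, sum_softmax, hx1, sub_self]
  have h4 := (Finset.sum_eq_sum_iff_of_le hle).1 (by linarith)
  funext i
  exact eq_of_mul_log_div_eq (hx i) (softmax_pos v i) (h4 i (Finset.mem_univ i))

lemma gibbs_softmax (v : ι → ℝ) :
    ∑ i, softmax v i * v i - ∑ i, softmax v i * Real.log (softmax v i) = logSumExp v := by
  have h := gibbs_identity v (softmax v) (sum_softmax v)
  simp only [sub_self, mul_zero, Finset.sum_const_zero] at h
  linarith

/-- Convexity of log-sum-exp, as a subgradient inequality. -/
lemma logSumExp_subgradient (a b : ι → ℝ) :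
    ∑ i, softmax a i * (b i - a i) ≤ logSumExp b - logSumExp a := by
  have h1 := gibbs_le b (softmax a) (fun i => (softmax_pos a i).le) (sum_softmax a)
  have h2 := gibbs_softmax a
  simp only [mul_sub, Finset.sum_sub_distrib]
  linarith

lemma abs_logSumExp_sub_le (a b : ι → ℝ) :
    |logSumExp b - logSumExp a| ≤ ∑ i, |b i - a i| := by
  have key : ∀ a b : ι → ℝ, logSumExp a - logSumExp b ≤ ∑ i, |b i - a i| := by
    intro a b
    have h := logSumExp_subgradient a b
    have : -∑ i, softmax a i * (b i - a i) ≤ ∑ i, |b i - a i| := by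
      rw [← Finset.sum_neg_distrib]
      refine Finset.sum_le_sum fun i _ => ?_
      calc -(softmax a i * (b i - a i)) ≤ |softmax a i * (b i - a i)| := neg_le_abs _
        _ = softmax a i * |b i - a i| := by rw [abs_mul, abs_of_pos (softmax_pos a i)]
        _ ≤ 1 * |b i - a i| := by gcongr; exact softmax_le_one a i
        _ = _ := one_mul _
    linarith
  rw [abs_sub_le_iff]
  refine ⟨?_, key a b⟩
  simpa only [abs_sub_comm] using key b a

lemma exp_taylor_three {w : ℝ} (hw : |w| ≤ 1) :
    |Real.exp w - (1 + w + w ^ 2 / 2)| ≤ |w| ^ 3 := by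
  have h := Real.exp_bound hw (n := 3) (by norm_num)
  simp [Finset.sum_range_succ, Nat.factorial] at h
  refine h.trans ?_
  nlinarith [pow_nonneg (abs_nonneg w) 3]

lemma log_taylor_three {s : ℝ} (hs : |s| ≤ 1 / 2) :
    |Real.log (1 + s) - (s - s ^ 2 / 2)| ≤ 2 * |s| ^ 3 := by
  have h := Real.abs_log_sub_add_sum_range_le (x := -s) (by rw [abs_neg]; linarith) 2
  simp [Finset.sum_range_succ] at h
  have e : -s + s ^ 2 / (1 + 1) + Real.log (1 + s) = Real.log (1 + s) - (s - s ^ 2 / 2) := by ring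
  rw [e] at h
  refine h.trans ?_
  rw [div_le_iff₀ (by linarith)]
  nlinarith [pow_nonneg (abs_nonneg s) 3]

/-- Second order expansion of the cumulant generating function with cubic remainder. -/
lemma log_sum_exp_expansion (p w : ι → ℝ) (hp : ∀ i, 0 ≤ p i) (hp1 : ∑ i, p i = 1)
    {M : ℝ} (hM : M ≤ 1 / 4) (hw : ∀ i, |w i| ≤ M) :
    |Real.log (∑ i, p i * Real.exp (w i)) -
      (∑ i, p i * w i + (∑ i, p i * w i ^ 2 - (∑ i, p i * w i) ^ 2) / 2)| ≤ 20 * M ^ 3 := by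
  obtain ⟨i0⟩ := ‹Nonempty ι›
  have hM0 : 0 ≤ M := (abs_nonneg _).trans (hw i0)
  set μ := ∑ i, p i * w i
  set V := ∑ i, p i * w i ^ 2
  have avg : ∀ (g : ι → ℝ) (B : ℝ), (∀ i, |g i| ≤ B) → |∑ i, p i * g i| ≤ B := by
    intro g B hB
    calc |∑ i, p i * g i| ≤ ∑ i, |p i * g i| := Finset.abs_sum_le_sum_abs _ _
      _ ≤ ∑ i, p i * B := Finset.sum_le_sum fun i _ => by
          rw [abs_mul, abs_of_nonneg (hp i)]; exact mul_le_mul_of_nonneg_left (hB i) (hp i)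
      _ = B := by rw [← Finset.sum_mul, hp1, one_mul]
  have hμ : |μ| ≤ M := avg w M hw
  have hV : |V| ≤ M ^ 2 := avg _ _ fun i => by
    rw [abs_pow]; exact pow_le_pow_left₀ (abs_nonneg _) (hw i) 2
  set R := ∑ i, p i * (Real.exp (w i) - (1 + w i + w i ^ 2 / 2)) with hR
  have hRb : |R| ≤ M ^ 3 := avg _ _ fun i =>
    (exp_taylor_three ((hw i).trans (by linarith))).trans
      (pow_le_pow_left₀ (abs_nonneg _) (hw i) 3)
  set s := μ + V / 2 + R with hs
  have hS : ∑ i, p i * Real.exp (w i) = 1 + s := by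
    have : ∑ i, p i * Real.exp (w i) = ∑ i, (p i + p i * w i + p i * w i ^ 2 / 2 +
        p i * (Real.exp (w i) - (1 + w i + w i ^ 2 / 2))) :=
      Finset.sum_congr rfl fun i _ => by ring
    rw [this, Finset.sum_add_distrib, Finset.sum_add_distrib, Finset.sum_add_distrib, hp1,
      ← Finset.sum_div]
    simp only [hs, hR, μ, V]; ring
  rw [hS]
  have hM2 : M ^ 2 ≤ M / 4 := by nlinarith
  have hM3 : M ^ 3 ≤ M ^ 2 / 4 := by nlinarith [sq_nonneg M]
  rw [abs_le] at hμ hV hRb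
  have ht : |V / 2 + R| ≤ M ^ 2 := by rw [abs_le]; constructor <;> linarith
  have hsb : |s| ≤ 5 / 4 * M := by
    rw [abs_le] at ht ⊢; constructor <;> linarith [ht.1, ht.2]
  have h1 := log_taylor_three (s := s) (by linarith)
  have h2 : |s| ^ 3 ≤ 2 * M ^ 3 := by
    calc |s| ^ 3 ≤ (5 / 4 * M) ^ 3 := pow_le_pow_left₀ (abs_nonneg _) hsb 3
      _ ≤ 2 * M ^ 3 := by nlinarith [pow_nonneg hM0 3]
  have h3 : |s ^ 2 - μ ^ 2| ≤ 3 * M ^ 3 := by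
    have : s ^ 2 - μ ^ 2 = (V / 2 + R) * (s + μ) := by rw [hs]; ring
    rw [this, abs_mul]
    have h4 : |s + μ| ≤ 9 / 4 * M := by
      rw [abs_le] at hsb ⊢; constructor <;> linarith [hsb.1, hsb.2]
    calc _ ≤ M ^ 2 * (9 / 4 * M) := mul_le_mul ht h4 (abs_nonneg _) (sq_nonneg _)
      _ ≤ 3 * M ^ 3 := by nlinarith [pow_nonneg hM0 3]
  rw [abs_le] at h1 h3 ⊢
  have hM30 := pow_nonneg hM0 3
  constructor <;> linarith [h1.1, h1.2, h3.1, h3.2]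

end LogSumExp

section DualEnergy

variable {q : ℕ} [NeZero q]

/-- The set of global minimizers of the free energy on the simplex. -/
def minimizers (q : ℕ) [NeZero q] (β h : ℝ) : Set (Fin q → ℝ) :=
  {y | y ∈ simplex q ∧ ∀ z ∈ simplex q, freeEnergy q β h y ≤ freeEnergy q β h z}

/-- The mean field acting on a single spin. -/
def meanField (β h : ℝ) (u : Fin q → ℝ) (k : Fin q) : ℝ := β * u k + if k = 0 then h else 0

/-- The Hubbard–Stratonovich dual of the free energy. -/
noncomputable def dualEnergy (β h : ℝ) (u : Fin q → ℝ) : ℝ :=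
  β / 2 * ∑ i, u i ^ 2 - logSumExp (meanField β h u)

/-- The Hessian quadratic form of the dual energy at a fixed point `p` of the mean-field map. -/
def hessForm (β : ℝ) (p v : Fin q → ℝ) : ℝ :=
  β * ∑ i, v i ^ 2 - β ^ 2 * (∑ i, p i * v i ^ 2 - (∑ i, p i * v i) ^ 2)

lemma sum_mul_meanField (β h : ℝ) (x u : Fin q → ℝ) :
    ∑ i, x i * meanField β h u i = β * ∑ i, x i * u i + h * x 0 := by
  simp only [meanField, mul_add, Finset.sum_add_distrib, mul_ite, mul_zero, Finset.sum_ite_eq',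
    Finset.mem_univ, if_true, Finset.mul_sum]
  rw [mul_comm h]
  congr 1
  exact Finset.sum_congr rfl fun i _ => by ring

lemma continuous_meanField (β h : ℝ) : Continuous (meanField (q := q) β h) := by
  unfold meanField; fun_prop

lemma continuous_dualEnergy (β h : ℝ) : Continuous (dualEnergy (q := q) β h) := by
  unfold dualEnergy
  have := (continuous_logSumExp (ι := Fin q)).comp (continuous_meanField β h)
  simp only [Function.comp_def] at this
  fun_prop

lemma softmax_mem_simplex (v : Fin q → ℝ) : softmax v ∈ simplex q :=
  ⟨fun i => (softmax_pos v i).le, sum_softmax v⟩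

lemma dualEnergy_eq (β h : ℝ) (u : Fin q → ℝ) :
    dualEnergy β h u = freeEnergy q β h (softmax (meanField β h u)) +
      β / 2 * ∑ i, (u i - softmax (meanField β h u) i) ^ 2 := by
  have h1 := gibbs_softmax (meanField β h u)
  rw [sum_mul_meanField] at h1
  set p := softmax (meanField β h u)
  have h2 : ∑ i, (u i - p i) ^ 2 = ∑ i, u i ^ 2 - 2 * ∑ i, p i * u i + ∑ i, p i ^ 2 := by
    rw [Finset.mul_sum, ← Finset.sum_sub_distrib, ← Finset.sum_add_distrib]
    exact Finset.sum_congr rfl fun i _ => by ring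
  rw [dualEnergy, freeEnergy, ← h1, h2]
  ring

lemma sum_mul_meanField_self (β h : ℝ) (x : Fin q → ℝ) :
    ∑ i, x i * meanField β h x i = β * ∑ i, x i ^ 2 + h * x 0 := by
  rw [sum_mul_meanField]
  simp only [sq]

lemma dualEnergy_le_freeEnergy (β h : ℝ) {x : Fin q → ℝ} (hx : x ∈ simplex q) :
    dualEnergy β h x ≤ freeEnergy q β h x := by
  have h1 := gibbs_le (meanField β h x) x hx.1 hx.2
  rw [sum_mul_meanField_self] at h1
  rw [dualEnergy, freeEnergy]
  linarith

lemma freeEnergy_le_dualEnergy {β h : ℝ} (hβ : 0 ≤ β) {x : Fin q → ℝ}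
    (hx : x ∈ minimizers q β h) (u : Fin q → ℝ) : freeEnergy q β h x ≤ dualEnergy β h u := by
  rw [dualEnergy_eq]
  have h1 := hx.2 _ (softmax_mem_simplex (meanField β h u))
  have h2 : 0 ≤ β / 2 * ∑ i, (u i - softmax (meanField β h u) i) ^ 2 :=
    mul_nonneg (by linarith) (Finset.sum_nonneg fun i _ => sq_nonneg _)
  linarith

lemma dualEnergy_eq_freeEnergy {β h : ℝ} (hβ : 0 ≤ β) {x : Fin q → ℝ}
    (hx : x ∈ minimizers q β h) : dualEnergy β h x = freeEnergy q β h x :=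
  le_antisymm (dualEnergy_le_freeEnergy β h hx.1) (freeEnergy_le_dualEnergy hβ hx x)

lemma minimizer_eq_softmax {β h : ℝ} (hβ : 0 ≤ β) {x : Fin q → ℝ}
    (hx : x ∈ minimizers q β h) : x = softmax (meanField β h x) := by
  refine eq_softmax_of_gibbs_eq _ _ hx.1.1 hx.1.2 ?_
  have h1 := dualEnergy_eq_freeEnergy hβ hx
  rw [dualEnergy, freeEnergy] at h1
  rw [sum_mul_meanField_self]
  linarith

lemma minimizer_pos {β h : ℝ} (hβ : 0 ≤ β) {x : Fin q → ℝ}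
    (hx : x ∈ minimizers q β h) (i : Fin q) : 0 < x i := by
  rw [minimizer_eq_softmax hβ hx]; exact softmax_pos _ _

lemma mem_minimizers_of_dualEnergy_le {β h : ℝ} (hβ : 0 < β) {x u : Fin q → ℝ}
    (hx : x ∈ minimizers q β h) (hu : dualEnergy β h u ≤ freeEnergy q β h x) :
    u ∈ minimizers q β h := by
  rw [dualEnergy_eq] at hu
  have h1 := hx.2 _ (softmax_mem_simplex (meanField β h u))
  have h2 : 0 ≤ ∑ i, (u i - softmax (meanField β h u) i) ^ 2 :=
    Finset.sum_nonneg fun i _ => sq_nonneg _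
  have h3 : ∑ i, (u i - softmax (meanField β h u) i) ^ 2 = 0 := by
    refine le_antisymm ?_ h2
    by_contra hc
    push Not at hc
    have := mul_pos (half_pos hβ) hc
    linarith
  have h4 : u = softmax (meanField β h u) := by
    funext i
    have := (Finset.sum_eq_zero_iff_of_nonneg (fun i _ => sq_nonneg _)).1 h3 i (Finset.mem_univ i)
    exact sub_eq_zero.1 (pow_eq_zero_iff two_ne_zero |>.1 this)
  rw [h3, mul_zero, add_zero, ← h4] at hu
  exact ⟨h4 ▸ softmax_mem_simplex _, fun z hz => hu.trans (hx.2 z hz)⟩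

lemma beta_pos_of_multiple {β h : ℝ} (hβ : 0 ≤ β) {x y : Fin q → ℝ}
    (hx : x ∈ minimizers q β h) (hy : y ∈ minimizers q β h) (hxy : x ≠ y) : 0 < β := by
  refine hβ.lt_of_ne fun h0 => hxy ?_
  rw [minimizer_eq_softmax hβ hx, minimizer_eq_softmax hβ hy]
  congr 1
  funext k
  simp [meanField, ← h0]

lemma log_minimizer {β h : ℝ} (hβ : 0 ≤ β) {x : Fin q → ℝ}
    (hx : x ∈ minimizers q β h) (i : Fin q) :
    Real.log (x i) = meanField β h x i - logSumExp (meanField β h x) := by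
  conv_lhs => rw [minimizer_eq_softmax hβ hx]
  exact log_softmax _ _

lemma dualEnergy_add_expansion {β h : ℝ} (hβ : 0 ≤ β) {y : Fin q → ℝ}
    (hy : y ∈ minimizers q β h) (v : Fin q → ℝ) {M : ℝ} (hM : β * M ≤ 1 / 4)
    (hv : ∀ i, |v i| ≤ M) :
    |dualEnergy β h (y + v) - dualEnergy β h y - hessForm β y v / 2| ≤ 20 * (β * M) ^ 3 := by
  have hexp := log_sum_exp_expansion y (fun i => β * v i) hy.1.1 hy.1.2 hM fun i => by
    rw [abs_mul, abs_of_nonneg hβ]; exact mul_le_mul_of_nonneg_left (hv i) hβ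
  have e1 : logSumExp (meanField β h (y + v)) =
      logSumExp (meanField β h y) + Real.log (∑ i, y i * Real.exp (β * v i)) := by
    have e : ∀ i, y i * Real.exp (β * v i) =
        Real.exp (meanField β h (y + v) i) / ∑ j, Real.exp (meanField β h y j) := by
      intro i
      conv_lhs => rw [minimizer_eq_softmax hβ hy]
      rw [softmax, div_mul_eq_mul_div, ← Real.exp_add]
      congr 2
      simp [meanField]; ring
    simp only [e]
    rw [← Finset.sum_div, Real.log_div (sum_exp_pos _).ne' (sum_exp_pos _).ne']
    simp only [logSumExp]; ring
  have e2 : ∑ i, y i * (β * v i) = β * ∑ i, y i * v i := by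
    rw [Finset.mul_sum]; exact Finset.sum_congr rfl fun i _ => by ring
  have e3 : ∑ i, y i * (β * v i) ^ 2 = β ^ 2 * ∑ i, y i * v i ^ 2 := by
    rw [Finset.mul_sum]; exact Finset.sum_congr rfl fun i _ => by ring
  have e4 : ∑ i, (y + v) i ^ 2 = ∑ i, y i ^ 2 + 2 * ∑ i, y i * v i + ∑ i, v i ^ 2 := by
    rw [Finset.mul_sum, ← Finset.sum_add_distrib, ← Finset.sum_add_distrib]
    exact Finset.sum_congr rfl fun i _ => by simp only [Pi.add_apply]; ring
  rw [e2, e3] at hexp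
  rw [← abs_neg]
  refine le_trans (le_of_eq ?_) hexp
  congr 1
  rw [dualEnergy, dualEnergy, hessForm, e1, e4]
  ring

omit [NeZero q] in
lemma hessForm_smul (β t : ℝ) (p v : Fin q → ℝ) :
    hessForm β p (t • v) = t ^ 2 * hessForm β p v := by
  have e1 : ∑ i, (t • v) i ^ 2 = t ^ 2 * ∑ i, v i ^ 2 := by
    rw [Finset.mul_sum]; exact Finset.sum_congr rfl fun i _ => by
      simp only [Pi.smul_apply, smul_eq_mul]; ring
  have e2 : ∑ i, p i * (t • v) i ^ 2 = t ^ 2 * ∑ i, p i * v i ^ 2 := by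
    rw [Finset.mul_sum]; exact Finset.sum_congr rfl fun i _ => by
      simp only [Pi.smul_apply, smul_eq_mul]; ring
  have e3 : ∑ i, p i * (t • v) i = t * ∑ i, p i * v i := by
    rw [Finset.mul_sum]; exact Finset.sum_congr rfl fun i _ => by
      simp only [Pi.smul_apply, smul_eq_mul]; ring
  rw [hessForm, hessForm, e1, e2, e3]; ring

lemma tendsto_dualEnergy_scaled {β h : ℝ} (hβ : 0 ≤ β) {y : Fin q → ℝ}
    (hy : y ∈ minimizers q β h) (v : Fin q → ℝ) {t : ℕ → ℝ} (ht : Tendsto t atTop (𝓝 0))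
    (ht0 : ∀ᶠ n in atTop, t n ≠ 0) :
    Tendsto (fun n => (dualEnergy β h (y + t n • v) - dualEnergy β h y) / t n ^ 2) atTop
      (𝓝 (hessForm β y v / 2)) := by
  obtain ⟨K, hK0, hK⟩ : ∃ K : ℝ, 0 ≤ K ∧ ∀ i, |v i| ≤ K :=
    ⟨‖v‖, norm_nonneg _, fun i => norm_le_pi_norm v i⟩
  have hsmall : ∀ᶠ n in atTop, β * (|t n| * K) ≤ 1 / 4 := by
    have : Tendsto (fun n => β * (|t n| * K)) atTop (𝓝 (β * (|0| * K))) :=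
      (ht.abs.mul_const K).const_mul β
    simp only [abs_zero, zero_mul, mul_zero] at this
    exact this.eventually_le_const (by norm_num)
  rw [tendsto_iff_norm_sub_tendsto_zero]
  have hbound : Tendsto (fun n => 20 * (β * K) ^ 3 * |t n|) atTop (𝓝 0) := by
    simpa using (ht.abs.const_mul (20 * (β * K) ^ 3))
  refine squeeze_zero' (Eventually.of_forall fun _ => norm_nonneg _) ?_ hbound
  filter_upwards [hsmall, ht0] with n h1 h2
  have h3 := dualEnergy_add_expansion hβ hy (t n • v) h1 fun i => by
    simp only [Pi.smul_apply, smul_eq_mul, abs_mul]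
    exact mul_le_mul_of_nonneg_left (hK i) (abs_nonneg _)
  rw [hessForm_smul] at h3
  have h4 : 0 < t n ^ 2 := by positivity
  have h5 : (dualEnergy β h (y + t n • v) - dualEnergy β h y) / t n ^ 2 - hessForm β y v / 2 =
      (dualEnergy β h (y + t n • v) - dualEnergy β h y - t n ^ 2 * hessForm β y v / 2) /
        t n ^ 2 := by
    field_simp
  rw [Real.norm_eq_abs, h5, abs_div, abs_of_pos h4, div_le_iff₀ h4]
  refine h3.trans (le_of_eq ?_)
  rw [← sq_abs (t n)]; ring

lemma hessForm_nonneg {β h : ℝ} (hβ : 0 ≤ β) {y : Fin q → ℝ}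
    (hy : y ∈ minimizers q β h) (v : Fin q → ℝ) : 0 ≤ hessForm β y v := by
  have hlim := tendsto_dualEnergy_scaled hβ hy v tendsto_one_div_add_atTop_nhds_zero_nat
    (Eventually.of_forall fun n => by positivity)
  have : 0 ≤ hessForm β y v / 2 := by
    refine ge_of_tendsto hlim (Eventually.of_forall fun n => ?_)
    refine div_nonneg ?_ (sq_nonneg _)
    rw [dualEnergy_eq_freeEnergy hβ hy, sub_nonneg]
    exact freeEnergy_le_dualEnergy hβ hy _
  linarith

end DualEnergy

section ScalarEquation

/-- The derivative of the two-state entropy, centred at one half. -/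
noncomputable def logOdds (s : ℝ) : ℝ := Real.log (1 / 2 + s) - Real.log (1 / 2 - s)

lemma logOdds_zero : logOdds 0 = 0 := by simp [logOdds]

lemma logOdds_neg (s : ℝ) : logOdds (-s) = -logOdds s := by
  simp only [logOdds, sub_neg_eq_add, ← sub_eq_add_neg]; ring

lemma hasDerivAt_logOdds {s : ℝ} (h1 : -(1 / 2) < s) (h2 : s < 1 / 2) :
    HasDerivAt logOdds (1 / (1 / 4 - s ^ 2)) s := by
  have ha : 0 < 1 / 2 + s := by linarith
  have hb : 0 < 1 / 2 - s := by linarith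
  have d1 := ((hasDerivAt_id s).const_add (1 / 2)).log ha.ne'
  have d2 := ((hasDerivAt_id s).const_sub (1 / 2)).log hb.ne'
  refine (d1.sub d2).congr_deriv ?_
  have : 1 / 4 - s ^ 2 = (1 / 2 + s) * (1 / 2 - s) := by ring
  rw [this]
  simp only [id]
  rw [neg_div, sub_neg_eq_add, div_add_div _ _ ha.ne' hb.ne']
  congr 1
  ring

lemma logOdds_slope {s : ℝ} (h1 : 0 < s) (h2 : s < 1 / 2) :
    4 * s < logOdds s ∧ logOdds s < s / (1 / 4 - s ^ 2) := by
  obtain ⟨c, hc, hs⟩ := exists_hasDerivAt_eq_slope logOdds (fun s => 1 / (1 / 4 - s ^ 2)) h1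
    (fun x hx =>
      (hasDerivAt_logOdds (by linarith [hx.1]) (by linarith [hx.2])).continuousAt.continuousWithinAt)
    (fun x hx => hasDerivAt_logOdds (by linarith [hx.1]) (by linarith [hx.2]))
  rw [logOdds_zero, sub_zero, sub_zero, eq_div_iff h1.ne'] at hs
  have hc0 : 0 < c ^ 2 := pow_pos hc.1 2
  have hcs : c ^ 2 < s ^ 2 := pow_lt_pow_left₀ hc.2 hc.1.le two_ne_zero
  have hs4 : s ^ 2 < 1 / 4 := by nlinarith
  rw [← hs]
  constructor
  · gcongr
    rw [lt_div_iff₀ (by linarith)]; linarith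
  · rw [div_mul_eq_mul_div, one_mul]
    exact div_lt_div_of_pos_left h1 (by linarith) (by linarith)

lemma strictConvexOn_logOdds : StrictConvexOn ℝ (Set.Ico 0 (1 / 2)) logOdds := by
  refine StrictMonoOn.strictConvexOn_of_deriv (convex_Ico _ _) (fun x hx =>
    (hasDerivAt_logOdds (by linarith [hx.1]) hx.2).continuousAt.continuousWithinAt) ?_
  rw [interior_Ico]
  intro x hx y hy hxy
  rw [(hasDerivAt_logOdds (by linarith [hx.1]) hx.2).deriv,
    (hasDerivAt_logOdds (by linarith [hy.1]) hy.2).deriv]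
  have := hx.1
  have := hy.2
  exact one_div_lt_one_div_of_lt (by nlinarith) (by nlinarith)

lemma logOdds_ratio_lt {s t : ℝ} (h1 : 0 < s) (hst : s < t) (h2 : t < 1 / 2) :
    t * logOdds s < s * logOdds t := by
  have ht : 0 < t := h1.trans hst
  have ha : 0 < 1 - s / t := by rw [sub_pos, div_lt_one ht]; exact hst
  have hmem : (0 : ℝ) ∈ Set.Ico (0 : ℝ) (1 / 2) := ⟨le_rfl, by norm_num⟩
  have h := strictConvexOn_logOdds.2 hmem ⟨ht.le, h2⟩ ht.ne ha (div_pos h1 ht) (by ring)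
  simp only [smul_eq_mul, mul_zero, zero_add, logOdds_zero, div_mul_cancel₀ _ ht.ne'] at h
  rw [div_mul_eq_mul_div, lt_div_iff₀ ht] at h
  linarith

lemma logOdds_abs {κ c s : ℝ} (hs : logOdds s = κ * s - c) (hc : c * s ≤ 0) :
    logOdds |s| = κ * |s| + |c| := by
  rcases lt_trichotomy s 0 with h | h | h
  · rw [abs_of_neg h, logOdds_neg, hs, abs_of_nonneg (by nlinarith)]; ring
  · subst h
    rw [logOdds_zero] at hs
    have : c = 0 := by linarith
    simp [this, logOdds_zero]
  · rw [abs_of_pos h, hs, abs_of_nonpos (by nlinarith)]; ring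

lemma not_lt_of_logOdds_eq {κ d s t : ℝ} (hd : 0 ≤ d) (hs0 : 0 ≤ s) (ht1 : t < 1 / 2)
    (hs : logOdds s = κ * s + d) (ht : logOdds t = κ * t + d)
    (h2 : 0 ≤ 1 - κ * (1 / 4 - s ^ 2)) : ¬ s < t := by
  intro hst
  rcases hs0.eq_or_lt with rfl | hs0
  · rw [logOdds_zero] at hs
    have := (logOdds_slope hst ht1).1
    nlinarith
  · have := logOdds_ratio_lt hs0 hst ht1
    rw [hs, ht] at this
    nlinarith

lemma sq_eq_sq_of_logOdds_eq {κ c s t : ℝ} (hs1 : |s| < 1 / 2) (ht1 : |t| < 1 / 2)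
    (hs : logOdds s = κ * s - c) (hsc : c * s ≤ 0) (hs2 : 0 ≤ 1 - κ * (1 / 4 - s ^ 2))
    (ht : logOdds t = κ * t - c) (htc : c * t ≤ 0) (ht2 : 0 ≤ 1 - κ * (1 / 4 - t ^ 2)) :
    s ^ 2 = t ^ 2 := by
  have hs' := logOdds_abs hs hsc
  have ht' := logOdds_abs ht htc
  rw [← sq_abs] at hs2 ht2
  have a1 := not_lt_of_logOdds_eq (abs_nonneg c) (abs_nonneg s) ht1 hs' ht' hs2
  have a2 := not_lt_of_logOdds_eq (abs_nonneg c) (abs_nonneg t) hs1 ht' hs' ht2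
  rw [← sq_abs s, ← sq_abs t, le_antisymm (not_lt.1 a2) (not_lt.1 a1)]

lemma nondegenerate_of_logOdds_eq {κ c s : ℝ} (hs1 : |s| < 1 / 2) (hs0 : s ≠ 0)
    (hs : logOdds s = κ * s - c) (hsc : c * s ≤ 0) : 0 < 1 - κ * (1 / 4 - s ^ 2) := by
  have hs' := logOdds_abs hs hsc
  have hp := abs_pos.2 hs0
  have h := (logOdds_slope hp hs1).2
  have hq : 0 < 1 / 4 - |s| ^ 2 := by nlinarith
  rw [hs', lt_div_iff₀ hq] at h
  rw [← sq_abs]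
  have h3 : κ * |s| * (1 / 4 - |s| ^ 2) < |s| := by
    nlinarith [mul_nonneg (abs_nonneg c) hq.le]
  have h4 : |s| * (κ * (1 / 4 - |s| ^ 2)) < |s| * 1 := by linarith
  linarith [lt_of_mul_lt_mul_left h4 hp.le]

end ScalarEquation

section Shape

variable {q : ℕ} [NeZero q]

lemma freeEnergy_comp_swap (β h : ℝ) (x : Fin q → ℝ) (i : Fin q) :
    freeEnergy q β h (x ∘ Equiv.swap 0 i) = freeEnergy q β h x - h * (x i - x 0) := by
  have e1 := Equiv.sum_comp (Equiv.swap 0 i) fun j => x j * Real.log (x j)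
  have e2 := Equiv.sum_comp (Equiv.swap 0 i) fun j => x j ^ 2
  simp only [freeEnergy, Function.comp_apply, e1, e2, Equiv.swap_apply_left]
  ring

lemma minimizer_le_zero {β h : ℝ} (hh : 0 < h) {y : Fin q → ℝ}
    (hy : y ∈ minimizers q β h) (i : Fin q) : y i ≤ y 0 := by
  have h1 := hy.2 (y ∘ Equiv.swap 0 i) ⟨fun j => hy.1.1 _, by
    rw [← hy.1.2]; exact Equiv.sum_comp (Equiv.swap 0 i) y⟩
  rw [freeEnergy_comp_swap] at h1
  nlinarith

lemma minimizer_eq_of_ne_max {β h : ℝ} (hβ : 0 < β) {y : Fin q → ℝ}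
    (hy : y ∈ minimizers q β h) {k : Fin q} (hk : h ≠ 0 → k = 0) (hmax : ∀ i, y i ≤ y k)
    {i j : Fin q} (hi : i ≠ k) (hj : j ≠ k) : ¬ y i < y j := by
  intro hij
  have hpi := minimizer_pos hβ.le hy i
  have hpj := minimizer_pos hβ.le hy j
  have hpk := minimizer_pos hβ.le hy k
  have field : ∀ l, l ≠ k → (if l = 0 then h else 0) = (0 : ℝ) := by
    intro l hl
    by_cases h0 : h = 0
    · simp [h0]
    · rw [hk h0] at hl; simp [hl]
  have li := log_minimizer hβ.le hy i
  have lj := log_minimizer hβ.le hy j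
  rw [meanField, field i hi] at li
  rw [meanField, field j hj] at lj
  have h1 : Real.log (y i / y j) < y i / y j - 1 :=
    Real.log_lt_sub_one_of_pos (div_pos hpi hpj) ((div_lt_one hpj).2 hij).ne
  rw [Real.log_div hpi.ne' hpj.ne', li, lj] at h1
  have h2 : y i / y j - 1 = -((y j - y i) / y j) := by field_simp; ring
  have h3 : (y j - y i) / y j < β * (y j - y i) := by linarith
  rw [div_lt_iff₀ hpj] at h3
  have h4 : 1 < β * y j := by nlinarith
  have h5 : 1 < β * y k := h4.trans_le (mul_le_mul_of_nonneg_left (hmax j) hβ.le)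
  have h6 := hessForm_nonneg hβ.le hy
    (fun l => if l = j then y k else if l = k then -y j else 0)
  have s : ∀ F : Fin q → ℝ, (∀ x, x ≠ j ∧ x ≠ k → F x = 0) → ∑ x, F x = F j + F k :=
    fun F hF => Fintype.sum_eq_add j k hj hF
  rw [hessForm, s _ (by rintro x ⟨a, b⟩; simp [a, b]), s _ (by rintro x ⟨a, b⟩; simp [a, b]),
    s _ (by rintro x ⟨a, b⟩; simp [a, b])] at h6
  simp only [if_true, hj.symm, if_false] at h6
  have h7 : β * (y k ^ 2 * (β * y j - 1) + y j ^ 2 * (β * y k - 1)) ≤ 0 := by linarith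
  have h8 : 0 < β * (y k ^ 2 * (β * y j - 1) + y j ^ 2 * (β * y k - 1)) := by
    have a1 : 0 < β * y j - 1 := by linarith
    have a2 : 0 < β * y k - 1 := by linarith
    positivity
  linarith

/-- A vector with value `a` at `k` and `b` elsewhere. -/
def spike (k : Fin q) (a b : ℝ) (i : Fin q) : ℝ := if i = k then a else b

omit [NeZero q] in
lemma sum_spike (F : ℝ → ℝ) (k : Fin q) (a b : ℝ) :
    ∑ i, F (spike k a b i) = F a + ((q : ℝ) - 1) * F b := by
  have h1 := Finset.add_sum_erase Finset.univ (fun i => F (spike k a b i)) (Finset.mem_univ k)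
  have h2 : ∑ i ∈ Finset.univ.erase k, F (spike k a b i) = ∑ i ∈ Finset.univ.erase k, F b :=
    Finset.sum_congr rfl fun i hi => by rw [spike, if_neg (Finset.ne_of_mem_erase hi)]
  rw [← h1, h2, Finset.sum_const, Finset.card_erase_of_mem (Finset.mem_univ k), Finset.card_univ,
    Fintype.card_fin, nsmul_eq_mul, Nat.cast_sub (by have := k.isLt; omega), Nat.cast_one]
  simp [spike]

/-- Every global minimizer takes at most two values, the larger one only once. -/
lemma minimizer_eq_spike (hq : 2 ≤ q) {β h : ℝ} (hβ : 0 < β) (hh : 0 ≤ h) {y : Fin q → ℝ}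
    (hy : y ∈ minimizers q β h) :
    ∃ k a b, (h ≠ 0 → k = 0) ∧ 0 < b ∧ b ≤ a ∧ y = spike k a b ∧ a + ((q : ℝ) - 1) * b = 1 := by
  obtain ⟨k, hk, hmax⟩ : ∃ k, (h ≠ 0 → k = 0) ∧ ∀ i, y i ≤ y k := by
    rcases hh.eq_or_lt with h0 | h0
    · obtain ⟨k, hk⟩ := Finite.exists_max y
      exact ⟨k, fun h1 => absurd h0.symm h1, hk⟩
    · exact ⟨0, fun _ => rfl, minimizer_le_zero h0 hy⟩
  obtain ⟨j, hj⟩ : ∃ j : Fin q, j ≠ k := by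
    have : Nontrivial (Fin q) := Fin.nontrivial_iff_two_le.2 hq
    exact exists_ne k
  have hs : y = spike k (y k) (y j) := by
    funext i
    rw [spike]
    split_ifs with hi
    · rw [hi]
    · exact le_antisymm (not_lt.1 (minimizer_eq_of_ne_max hβ hy hk hmax hj hi))
        (not_lt.1 (minimizer_eq_of_ne_max hβ hy hk hmax hi hj))
  refine ⟨k, y k, y j, hk, minimizer_pos hβ.le hy j, hmax j, hs, ?_⟩
  have h1 := hy.1.2
  rw [hs, sum_spike fun t => t] at h1
  exact h1

omit [NeZero q] in
/-- Diagonalization of the Hessian form at a two-valued probability vector. -/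
lemma hessForm_spike (hq : 2 ≤ q) (β : ℝ) (k : Fin q) {a b : ℝ}
    (hab : a + ((q : ℝ) - 1) * b = 1) (v : Fin q → ℝ) :
    let S := ∑ i ∈ Finset.univ.erase k, v i
    let T := ∑ i ∈ Finset.univ.erase k, v i ^ 2
    hessForm β (spike k a b) v = β * ((v k + S) ^ 2 / q +
      (1 - q * β * a * b) * (((q : ℝ) - 1) * v k - S) ^ 2 / (q * ((q : ℝ) - 1)) +
      (1 - β * b) * (T - S ^ 2 / ((q : ℝ) - 1))) := by
  intro S T
  have hq1 : (0 : ℝ) < q - 1 := by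
    have : (2 : ℝ) ≤ q := by exact_mod_cast hq
    linarith
  have hq0 : (0 : ℝ) < q := by linarith
  have e1 : ∑ i, v i ^ 2 = v k ^ 2 + T :=
    (Finset.add_sum_erase Finset.univ (fun i => v i ^ 2) (Finset.mem_univ k)).symm
  have e2 : ∑ i, spike k a b i * v i ^ 2 = a * v k ^ 2 + b * T := by
    rw [← Finset.add_sum_erase Finset.univ _ (Finset.mem_univ k), Finset.mul_sum]
    congr 1
    · simp [spike]
    · exact Finset.sum_congr rfl fun i hi => by rw [spike, if_neg (Finset.ne_of_mem_erase hi)]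
  have e3 : ∑ i, spike k a b i * v i = a * v k + b * S := by
    rw [← Finset.add_sum_erase Finset.univ _ (Finset.mem_univ k), Finset.mul_sum]
    congr 1
    · simp [spike]
    · exact Finset.sum_congr rfl fun i hi => by rw [spike, if_neg (Finset.ne_of_mem_erase hi)]
  rw [hessForm, e1, e2, e3]
  have ha : a = 1 - ((q : ℝ) - 1) * b := by linarith
  rw [ha]
  field_simp
  ring

omit [NeZero q] in
lemma sq_sum_erase_le (hq : 2 ≤ q) (k : Fin q) (v : Fin q → ℝ) :
    (∑ i ∈ Finset.univ.erase k, v i) ^ 2 / ((q : ℝ) - 1) ≤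
      ∑ i ∈ Finset.univ.erase k, v i ^ 2 := by
  have hq1 : (0 : ℝ) < q - 1 := by
    have : (2 : ℝ) ≤ q := by exact_mod_cast hq
    linarith
  rw [div_le_iff₀ hq1]
  have h := sq_sum_le_card_mul_sum_sq (s := Finset.univ.erase k) (f := v)
  rw [Finset.card_erase_of_mem (Finset.mem_univ k), Finset.card_univ, Fintype.card_fin,
    Nat.cast_sub (by omega), Nat.cast_one] at h
  linarith

omit [NeZero q] in
lemma hessForm_lower_bound (hq : 2 ≤ q) {β : ℝ} (hβ : 0 < β) (k : Fin q) {a b : ℝ}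
    (hab : a + ((q : ℝ) - 1) * b = 1) (h1 : 0 < 1 - q * β * a * b) (h2 : 0 < 1 - β * b) :
    ∃ c > 0, ∀ v : Fin q → ℝ, c * ∑ i, v i ^ 2 ≤ hessForm β (spike k a b) v := by
  refine ⟨β * min 1 (min (1 - q * β * a * b) (1 - β * b)),
    mul_pos hβ (lt_min one_pos (lt_min h1 h2)), fun v => ?_⟩
  rw [hessForm_spike hq β k hab v, mul_assoc]
  refine mul_le_mul_of_nonneg_left ?_ hβ.le
  set c := min 1 (min (1 - q * β * a * b) (1 - β * b))
  have c1 : c ≤ 1 := min_le_left _ _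
  have c2 : c ≤ 1 - q * β * a * b := (min_le_right _ _).trans (min_le_left _ _)
  have c3 : c ≤ 1 - β * b := (min_le_right _ _).trans (min_le_right _ _)
  have hq1 : (0 : ℝ) < q - 1 := by
    have : (2 : ℝ) ≤ q := by exact_mod_cast hq
    linarith
  have hq0 : (0 : ℝ) < q := by linarith
  have hT := sq_sum_erase_le hq k v
  rw [← Finset.add_sum_erase Finset.univ (fun i => v i ^ 2) (Finset.mem_univ k)]
  set S := ∑ i ∈ Finset.univ.erase k, v i
  set T := ∑ i ∈ Finset.univ.erase k, v i ^ 2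
  have e : v k ^ 2 + T = (v k + S) ^ 2 / q +
      (((q : ℝ) - 1) * v k - S) ^ 2 / (q * ((q : ℝ) - 1)) + (T - S ^ 2 / ((q : ℝ) - 1)) := by
    field_simp; ring
  rw [e, mul_add, mul_add, mul_div_assoc (1 - q * β * a * b)]
  have p1 : 0 ≤ (v k + S) ^ 2 / q := by positivity
  have p2 : 0 ≤ (((q : ℝ) - 1) * v k - S) ^ 2 / (q * ((q : ℝ) - 1)) := by positivity
  have p3 : 0 ≤ T - S ^ 2 / ((q : ℝ) - 1) := by linarith
  refine add_le_add (add_le_add ?_ (mul_le_mul_of_nonneg_right c2 p2))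
    (mul_le_mul_of_nonneg_right c3 p3)
  calc _ ≤ 1 * ((v k + S) ^ 2 / q) := mul_le_mul_of_nonneg_right c1 p1
    _ = _ := one_mul _

/-- The constant tilt of the one-dimensional reduced free energy. -/
noncomputable def spikeTilt (q : ℕ) (β h : ℝ) : ℝ :=
  Real.log ((q : ℝ) - 1) - h - β / 2 * (1 - 1 / ((q : ℝ) - 1))

lemma spike_data (hq : 2 ≤ q) {β h : ℝ} (hβ : 0 < β) {k : Fin q} {a b : ℝ}
    (hk : h ≠ 0 → k = 0) (hb : 0 < b) (hba : b ≤ a)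
    (hab : a + ((q : ℝ) - 1) * b = 1) (hy : spike k a b ∈ minimizers q β h) :
    |a - 1 / 2| < 1 / 2 ∧
    logOdds (a - 1 / 2) = β * (q / ((q : ℝ) - 1)) * (a - 1 / 2) - spikeTilt q β h ∧
    spikeTilt q β h * (a - 1 / 2) ≤ 0 ∧
    0 ≤ 1 - β * (q / ((q : ℝ) - 1)) * (1 / 4 - (a - 1 / 2) ^ 2) ∧
    1 - q * β * a * b = 1 - β * (q / ((q : ℝ) - 1)) * (1 / 4 - (a - 1 / 2) ^ 2) := by
  have hq1 : (0 : ℝ) < q - 1 := by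
    have : (2 : ℝ) ≤ q := by exact_mod_cast hq
    linarith
  have hq0 : (0 : ℝ) < q := by linarith
  have ha : 0 < a := hb.trans_le hba
  have ha1 : 0 < 1 - a := by nlinarith
  have hbe : b = (1 - a) / ((q : ℝ) - 1) := by field_simp; linarith
  have hprod : 1 - q * β * a * b = 1 - β * (q / ((q : ℝ) - 1)) * (1 / 4 - (a - 1 / 2) ^ 2) := by
    rw [hbe]; field_simp; ring
  obtain ⟨j, hj⟩ : ∃ j : Fin q, j ≠ k := by
    have : Nontrivial (Fin q) := Fin.nontrivial_iff_two_le.2 hq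
    exact exists_ne k
  refine ⟨by rw [abs_lt]; constructor <;> linarith, ?_, ?_, ?_, hprod⟩
  · have lk := log_minimizer hβ.le hy k
    have lj := log_minimizer hβ.le hy j
    have fk : (if k = 0 then h else 0) = h := by
      by_cases h0 : h = 0
      · simp [h0]
      · simp [hk h0]
    have fj : (if j = 0 then h else 0) = 0 := by
      by_cases h0 : h = 0
      · simp [h0]
      · rw [hk h0] at hj; simp [hj]
    simp only [meanField, fk, fj, spike, hj, if_true, if_false] at lk lj
    have lb : Real.log b = Real.log (1 - a) - Real.log ((q : ℝ) - 1) := by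
      rw [hbe, Real.log_div ha1.ne' hq1.ne']
    have e1 : (1 : ℝ) / 2 + (a - 1 / 2) = a := by ring
    have e2 : (1 : ℝ) / 2 - (a - 1 / 2) = 1 - a := by ring
    have e3 : β * (q / ((q : ℝ) - 1)) * (a - 1 / 2) =
        β * (a - b) - β / 2 * (1 - 1 / ((q : ℝ) - 1)) := by
      rw [hbe]; field_simp; ring
    rw [logOdds, e1, e2, spikeTilt, e3]
    linarith
  · set b' := a / ((q : ℝ) - 1) with hb'
    have hmem : spike k (1 - a) b' ∈ simplex q := by
      constructor
      · intro i
        rw [spike]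
        split_ifs
        · exact ha1.le
        · positivity
      · rw [sum_spike fun t => t, hb']; field_simp; ring
    have hmin := hy.2 _ hmem
    have fe : ∀ s t : ℝ, freeEnergy q β h (spike k s t) =
        (s * Real.log s + ((q : ℝ) - 1) * (t * Real.log t)) -
          β / 2 * (s ^ 2 + ((q : ℝ) - 1) * t ^ 2) - h * s := by
      intro s t
      rw [freeEnergy, sum_spike fun t => t * Real.log t, sum_spike fun t => t ^ 2]
      by_cases h0 : h = 0
      · simp [h0]
      · rw [hk h0]; simp [spike]
    rw [fe, fe] at hmin
    have lb : Real.log b = Real.log (1 - a) - Real.log ((q : ℝ) - 1) := by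
      rw [hbe, Real.log_div ha1.ne' hq1.ne']
    have lb' : Real.log b' = Real.log a - Real.log ((q : ℝ) - 1) := by
      rw [hb', Real.log_div ha.ne' hq1.ne']
    rw [lb, lb', hbe, hb'] at hmin
    have x1 : ∀ z w : ℝ, ((q : ℝ) - 1) * (z / ((q : ℝ) - 1) * w) = z * w := by
      intro z w; field_simp
    have x2 : ∀ z : ℝ, ((q : ℝ) - 1) * (z / ((q : ℝ) - 1)) ^ 2 = z ^ 2 * (1 / ((q : ℝ) - 1)) := by
      intro z; field_simp
    rw [x1, x1, x2, x2] at hmin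
    rw [spikeTilt]
    nlinarith
  · rw [← hprod]
    have h6 := hessForm_nonneg hβ.le hy (spike k ((q : ℝ) - 1) (-1))
    rw [hessForm_spike hq β k hab] at h6
    have s1 : ∑ i ∈ Finset.univ.erase k, spike k ((q : ℝ) - 1) (-1) i = -((q : ℝ) - 1) := by
      have := Finset.add_sum_erase Finset.univ (spike k ((q : ℝ) - 1) (-1)) (Finset.mem_univ k)
      rw [sum_spike fun t => t] at this
      simp only [spike, if_true] at this ⊢
      linarith
    have s2 : ∑ i ∈ Finset.univ.erase k, spike k ((q : ℝ) - 1) (-1) i ^ 2 = (q : ℝ) - 1 := by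
      have := Finset.add_sum_erase Finset.univ (fun i => spike k ((q : ℝ) - 1) (-1) i ^ 2)
        (Finset.mem_univ k)
      rw [sum_spike fun t => t ^ 2] at this
      simp only [spike, if_true] at this ⊢
      linarith
    simp only [s1, s2] at h6
    have s3 : spike k ((q : ℝ) - 1) (-1) k = (q : ℝ) - 1 := by simp [spike]
    rw [s3] at h6
    by_contra hc
    push Not at hc
    have h7 : β * ((((q : ℝ) - 1) + -((q : ℝ) - 1)) ^ 2 / q + (1 - q * β * a * b) *
        (((q : ℝ) - 1) * ((q : ℝ) - 1) - -((q : ℝ) - 1)) ^ 2 / (q * ((q : ℝ) - 1)) +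
        (1 - β * b) * (((q : ℝ) - 1) - (-((q : ℝ) - 1)) ^ 2 / ((q : ℝ) - 1))) =
        (1 - q * β * a * b) * (β * (q * ((q : ℝ) - 1))) := by
      field_simp; ring
    rw [h7] at h6
    exact absurd h6 (not_le.2 (mul_neg_of_neg_of_pos hc (by positivity)))

/-- At coexistence all minimizers are nondegenerate with a common value of `1 - qβab`. -/
theorem coexistence_structure (hq : 2 ≤ q) {β h : ℝ} (hβ : 0 < β) (hh : 0 ≤ h)
    {x x' : Fin q → ℝ} (hx : x ∈ minimizers q β h) (hx' : x' ∈ minimizers q β h) (hne : x' ≠ x) :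
    ∃ ρ > 0, ∀ y ∈ minimizers q β h, ∃ k a b, y = spike k a b ∧ b ≤ a ∧
      a + ((q : ℝ) - 1) * b = 1 ∧ 1 - q * β * a * b = ρ ∧ 0 < 1 - β * b := by
  have hq2 : (2 : ℝ) ≤ q := by exact_mod_cast hq
  have hq1 : (0 : ℝ) < q - 1 := by linarith
  have hq0 : (0 : ℝ) < q := by linarith
  obtain ⟨k, a, b, hk, hb, hba, rfl, hab⟩ := minimizer_eq_spike hq hβ hh hx
  obtain ⟨d1, d2, d3, d4, d5⟩ := spike_data hq hβ hk hb hba hab hx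
  have hsq : ∀ k' a' b', (h ≠ 0 → k' = 0) → 0 < b' → b' ≤ a' → a' + ((q : ℝ) - 1) * b' = 1 →
      spike k' a' b' ∈ minimizers q β h → (a' - 1 / 2) ^ 2 = (a - 1 / 2) ^ 2 := by
    intro k' a' b' hk' hb' hba' hab' hy'
    obtain ⟨e1, e2, e3, e4, -⟩ := spike_data hq hβ hk' hb' hba' hab' hy'
    exact sq_eq_sq_of_logOdds_eq e1 d1 e2 e3 e4 d2 d3 d4
  have hρ : 0 < 1 - q * β * a * b := by
    rw [d5]
    by_cases hs : a - 1 / 2 = 0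
    · refine d4.lt_of_ne fun hdeg => ?_
      obtain ⟨k', a', b', hk', hb', hba', rfl, hab'⟩ := minimizer_eq_spike hq hβ hh hx'
      have h1 := hsq k' a' b' hk' hb' hba' hab' hx'
      have ha : a = 1 / 2 := by linarith
      have ha' : a' = 1 / 2 := by
        rw [hs] at h1
        have := pow_eq_zero_iff (two_ne_zero) |>.1 (h1.trans (by norm_num))
        linarith
      have hbb : b' = b := by
        have : ((q : ℝ) - 1) * (b' - b) = 0 := by linarith
        rcases mul_eq_zero.1 this with h2 | h2 <;> linarith
      have hkk : k' ≠ k := by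
        rintro rfl
        exact hne (by rw [hbb, ha, ha'])
      have h0 : h = 0 := by
        by_contra h0
        exact hkk ((hk' h0).trans (hk h0).symm)
      rw [hs] at d2 hdeg
      rw [logOdds_zero, mul_zero, zero_sub, spikeTilt, h0] at d2
      have hβq : β = 4 * ((q : ℝ) - 1) / q := by
        field_simp at hdeg ⊢
        linarith
      rcases hq.eq_or_lt with hq' | hq'
      · subst hq'
        have hb2 : b = 1 / 2 := by push_cast at hab; linarith
        apply hne
        funext i
        simp [spike, ha, ha', hbb, hb2]
      · have hq3 : (3 : ℝ) ≤ q := by exact_mod_cast hq'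
        have hs1 : (0 : ℝ) < 1 / 2 - 1 / q := by
          rw [sub_pos]; exact one_div_lt_one_div_of_lt (by norm_num) (by linarith)
        have hs2 : (1 : ℝ) / 2 - 1 / q < 1 / 2 := by
          have : (0 : ℝ) < 1 / q := by positivity
          linarith
        have h3 := (logOdds_slope hs1 hs2).1
        have e1 : (1 : ℝ) / 2 + (1 / 2 - 1 / q) = (q - 1) / q := by field_simp; ring
        have e2 : (1 : ℝ) / 2 - (1 / 2 - 1 / q) = 1 / q := by ring
        rw [logOdds, e1, e2, Real.log_div hq1.ne' hq0.ne', Real.log_div one_ne_zero hq0.ne',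
          Real.log_one] at h3
        have e3 : β / 2 * (1 - 1 / ((q : ℝ) - 1)) = 4 * (1 / 2 - 1 / q) := by
          rw [hβq]; field_simp; ring
        rw [e3] at d2
        linarith
    · exact nondegenerate_of_logOdds_eq d1 hs d2 d3
  refine ⟨_, hρ, fun y hy => ?_⟩
  obtain ⟨k', a', b', hk', hb', hba', rfl, hab'⟩ := minimizer_eq_spike hq hβ hh hy
  have e5 := (spike_data hq hβ hk' hb' hba' hab' hy).2.2.2.2
  have h1 := hsq k' a' b' hk' hb' hba' hab' hy
  have h2 : 1 - q * β * a' * b' = 1 - q * β * a * b := by rw [e5, d5, h1]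
  refine ⟨k', a', b', rfl, hba', hab', h2, ?_⟩
  have h3 : 1 ≤ q * a' := by nlinarith
  have h4 : β * b' * 1 ≤ β * b' * (q * a') := mul_le_mul_of_nonneg_left h3 (by positivity)
  linarith

end Shape

section GaussianIntegrals

variable {ι : Type*} [Fintype ι]

lemma exp_neg_mul_sum_sq (b : ℝ) (v : ι → ℝ) :
    Real.exp (-b * ∑ i, v i ^ 2) = ∏ i, Real.exp (-b * v i ^ 2) := by
  rw [← Real.exp_sum, Finset.mul_sum]

lemma integrable_exp_neg_mul_sum_sq {b : ℝ} (hb : 0 < b) :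
    Integrable fun v : ι → ℝ => Real.exp (-b * ∑ i, v i ^ 2) := by
  simp only [exp_neg_mul_sum_sq]
  exact Integrable.fintype_prod fun _ => integrable_exp_neg_mul_sq hb

lemma integral_exp_neg_mul_sum_sq (b : ℝ) :
    ∫ v : ι → ℝ, Real.exp (-b * ∑ i, v i ^ 2) = √(π / b) ^ Fintype.card ι := by
  simp only [exp_neg_mul_sum_sq]
  rw [integral_fintype_prod_volume_eq_pow fun t : ℝ => Real.exp (-b * t ^ 2), integral_gaussian]

open Matrix in
lemma integral_exp_neg_half_posDef [DecidableEq ι] {H : Matrix ι ι ℝ} (hH : H.PosDef) :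
    ∫ v : ι → ℝ, Real.exp (-(v ⬝ᵥ H *ᵥ v) / 2) = √(2 * π) ^ Fintype.card ι / √H.det := by
  obtain ⟨B, hB⟩ : ∃ B : Matrix ι ι ℝ, H = Bᵀ * B := by
    open scoped MatrixOrder in
    obtain ⟨B, hB⟩ := CStarAlgebra.nonneg_iff_eq_star_mul_self.1 hH.posSemidef.nonneg
    exact ⟨B, by rw [hB, star_eq_conjTranspose, conjTranspose_eq_transpose_of_trivial]⟩
  have hdet : H.det = B.det ^ 2 := by rw [hB, det_mul, det_transpose, sq]
  have hB0 : B.det ≠ 0 := by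
    intro h0
    have := hH.det_pos
    rw [hdet, h0] at this
    norm_num at this
  have hquad : ∀ v : ι → ℝ, v ⬝ᵥ H *ᵥ v = ∑ i, (toLin' B v) i ^ 2 := by
    intro v
    rw [hB, ← mulVec_mulVec, dotProduct_mulVec, vecMul_transpose, dotProduct, toLin'_apply]
    simp only [sq]
  have hmap := Real.map_matrix_volume_pi_eq_smul_volume_pi hB0
  have hcont : Continuous (toLin' B) := LinearMap.continuous_of_finiteDimensional _
  have h1 := integral_map (μ := (volume : Measure (ι → ℝ))) (φ := toLin' B) hcont.aemeasurable
    (f := fun w : ι → ℝ => Real.exp (-(1 / 2) * ∑ i, w i ^ 2))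
    (Continuous.aestronglyMeasurable (by fun_prop))
  rw [hmap, integral_smul_measure, integral_exp_neg_mul_sum_sq,
    ENNReal.toReal_ofReal (abs_nonneg _)] at h1
  rw [hdet, Real.sqrt_sq_eq_abs, div_eq_inv_mul, ← abs_inv]
  have h2 : π / (1 / 2) = 2 * π := by ring
  rw [h2, smul_eq_mul] at h1
  rw [h1]
  congr 1
  funext v
  rw [hquad]
  congr 1
  ring

end GaussianIntegrals

section HessianIntegral

variable {q : ℕ}

open Matrix in
/-- The matrix of `hessForm`. -/
def hessMatrix (β : ℝ) (p : Fin q → ℝ) : Matrix (Fin q) (Fin q) ℝ :=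
  diagonal (fun i => β - β ^ 2 * p i) + β ^ 2 • vecMulVec p p

open Matrix in
lemma dotProduct_hessMatrix (β : ℝ) (p v : Fin q → ℝ) :
    v ⬝ᵥ hessMatrix β p *ᵥ v = hessForm β p v := by
  rw [hessMatrix, add_mulVec, dotProduct_add, smul_mulVec, dotProduct_smul, vecMulVec_mulVec,
    dotProduct_smul]
  simp only [dotProduct, mulVec_diagonal, smul_eq_mul, hessForm, op_smul_eq_smul]
  have e1 : ∑ i, v i * ((β - β ^ 2 * p i) * v i) =
      β * ∑ i, v i ^ 2 - β ^ 2 * ∑ i, p i * v i ^ 2 := by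
    rw [Finset.mul_sum, Finset.mul_sum, ← Finset.sum_sub_distrib]
    exact Finset.sum_congr rfl fun i _ => by ring
  have e2 : ∑ i, v i * p i = ∑ i, p i * v i := Finset.sum_congr rfl fun i _ => mul_comm _ _
  rw [e1, e2]; ring

open Matrix in
lemma det_hessMatrix_spike (hq : 2 ≤ q) {β : ℝ} (hβ : 0 < β) (k : Fin q) {a b : ℝ}
    (hab : a + ((q : ℝ) - 1) * b = 1) (h2 : 0 < 1 - β * b) :
    (hessMatrix β (spike k a b)).det =
      β ^ q * (1 - q * β * a * b) * (1 - β * b) ^ (q - 2) := by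
  set p := spike k a b with hp
  set μ := β * (1 - β * b) with hμdef
  have hμ : μ ≠ 0 := (mul_pos hβ h2).ne'
  set U : Matrix (Fin q) (Fin 2) ℝ := of fun i j => if j = 0 then (Pi.single k 1 : Fin q → ℝ) i else p i
    with hU
  set V : Matrix (Fin 2) (Fin q) ℝ := of fun j i =>
    if j = 0 then -(β ^ 2 * (a - b) / μ) * (Pi.single k 1 : Fin q → ℝ) i else β ^ 2 / μ * p i
    with hV
  have hdecomp : hessMatrix β p = μ • (1 + U * V) := by
    ext i j
    have hpi : p i = b + (a - b) * (Pi.single k 1 : Fin q → ℝ) i := by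
      simp only [hp, spike, Pi.single_apply]; split_ifs <;> ring
    have hsq : ∀ i, (Pi.single k 1 : Fin q → ℝ) i * (Pi.single k 1 : Fin q → ℝ) i =
        (Pi.single k 1 : Fin q → ℝ) i := by
      intro i; simp only [Pi.single_apply]; split_ifs <;> ring
    have hne : ∀ i j, i ≠ j → (Pi.single k 1 : Fin q → ℝ) i * (Pi.single k 1 : Fin q → ℝ) j = 0 := by
      intro i j hij
      simp only [Pi.single_apply]
      split_ifs with h1 h2
      · exact absurd (h1.trans h2.symm) hij
      all_goals ring
    simp only [hessMatrix, Matrix.add_apply, Matrix.smul_apply, vecMulVec_apply, smul_eq_mul,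
      Matrix.mul_apply, Fin.sum_univ_two, hU, hV, of_apply, if_true, if_false,
      one_ne_zero, Fin.isValue]
    by_cases hij : i = j
    · subst hij
      have := hsq i
      rw [diagonal_apply_eq, one_apply_eq]
      generalize (Pi.single k 1 : Fin q → ℝ) i = e at *
      rw [hpi]
      field_simp
      rw [hμdef]
      linear_combination (β ^ 2 * (a - b)) * this
    · have := hne i j hij
      rw [diagonal_apply_ne _ hij, one_apply_ne hij]
      generalize (Pi.single k 1 : Fin q → ℝ) i = e at *
      generalize (Pi.single k 1 : Fin q → ℝ) j = e' at *
      field_simp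
      linear_combination (β ^ 2 * (a - b)) * this
  have hVU : (1 + V * U).det =
      (1 - β ^ 2 * (a - b) / μ) * (1 + β ^ 2 / μ * (a ^ 2 + ((q : ℝ) - 1) * b ^ 2)) +
        β ^ 2 * (a - b) / μ * (β ^ 2 / μ) * a ^ 2 := by
    have s1 : ∑ i, p i * p i = a ^ 2 + ((q : ℝ) - 1) * b ^ 2 := by
      rw [hp, sum_spike fun t => t * t]; ring
    have s2 : p k = a := by simp [hp, spike]
    have m00 : (V * U) 0 0 = -(β ^ 2 * (a - b) / μ) := by
      simp [Matrix.mul_apply, hU, hV, Pi.single_apply]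
    have m01 : (V * U) 0 1 = -(β ^ 2 * (a - b) / μ) * a := by
      simp [Matrix.mul_apply, hU, hV, Pi.single_apply, s2]
    have m10 : (V * U) 1 0 = β ^ 2 / μ * a := by
      simp [Matrix.mul_apply, hU, hV, Pi.single_apply, s2]
    have m11 : (V * U) 1 1 = β ^ 2 / μ * (a ^ 2 + ((q : ℝ) - 1) * b ^ 2) := by
      simp only [Matrix.mul_apply, hU, hV, of_apply, one_ne_zero, if_false, mul_assoc]
      rw [← Finset.mul_sum, s1]
    rw [det_fin_two]
    simp only [Matrix.add_apply, m00, m01, m10, m11, one_apply_eq, one_apply_ne zero_ne_one,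
      one_apply_ne one_ne_zero]
    ring
  rw [hdecomp, det_smul, Fintype.card_fin, det_one_add_mul_comm, hVU]
  obtain ⟨m, rfl⟩ : ∃ m, q = m + 2 := ⟨q - 2, by omega⟩
  have ha : a = 1 - ((m + 2 : ℕ) - 1 : ℝ) * b := by linarith
  have key : μ ^ 2 * ((1 - β ^ 2 * (a - b) / μ) *
      (1 + β ^ 2 / μ * (a ^ 2 + (((m + 2 : ℕ) : ℝ) - 1) * b ^ 2)) +
        β ^ 2 * (a - b) / μ * (β ^ 2 / μ) * a ^ 2) =
      β ^ 2 * (1 - ((m + 2 : ℕ) : ℝ) * β * a * b) := by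
    field_simp
    rw [hμdef, ha]
    ring
  rw [Nat.add_sub_cancel, pow_add, mul_assoc, key, hμdef, mul_pow, pow_add]
  ring

open Matrix in
lemma integral_exp_hessForm_spike (hq : 2 ≤ q) {β : ℝ} (hβ : 0 < β) (k : Fin q) {a b : ℝ}
    (hab : a + ((q : ℝ) - 1) * b = 1) (h1 : 0 < 1 - q * β * a * b) (h2 : 0 < 1 - β * b) :
    ∫ v : Fin q → ℝ, Real.exp (-hessForm β (spike k a b) v / 2) =
      √(2 * π) ^ q / √(β ^ q * (1 - q * β * a * b)) * (1 - β * b) ^ (((2 : ℝ) - q) / 2) := by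
  have hPD : (hessMatrix β (spike k a b)).PosDef := by
    refine PosDef.of_dotProduct_mulVec_pos ?_ fun v hv => ?_
    · ext i j
      simp [hessMatrix, vecMulVec_apply, diagonal_apply, mul_comm (spike k a b j)]
      split_ifs with h h' h' <;> simp_all
    · rw [star_trivial, dotProduct_hessMatrix]
      obtain ⟨c, hc, hcv⟩ := hessForm_lower_bound hq hβ k hab h1 h2
      obtain ⟨i, hi⟩ := Function.ne_iff.1 hv
      refine lt_of_lt_of_le (mul_pos hc ?_) (hcv v)
      exact Finset.sum_pos' (fun i _ => sq_nonneg _) ⟨i, Finset.mem_univ i, by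
        have : v i ≠ 0 := hi
        positivity⟩
  have h3 := integral_exp_neg_half_posDef hPD
  simp only [dotProduct_hessMatrix, Fintype.card_fin] at h3
  rw [h3, det_hessMatrix_spike hq hβ k hab h2, Real.sqrt_mul (mul_nonneg (pow_nonneg hβ.le q) h1.le),
    div_mul_eq_div_div,
    div_eq_mul_inv (_ / _)]
  congr 1
  rw [Real.sqrt_eq_rpow, ← Real.rpow_natCast, ← Real.rpow_mul h2.le, ← Real.rpow_neg h2.le]
  congr 1
  rw [Nat.cast_sub hq]
  push_cast
  ring

end HessianIntegral

section Distance

variable {q : ℕ}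

/-- The Euclidean distance on `Fin q → ℝ`. -/
noncomputable def l2Dist (x y : Fin q → ℝ) : ℝ := √(∑ i, (x i - y i) ^ 2)

lemma l2Dist_eq_dist (x y : Fin q → ℝ) :
    l2Dist x y = dist (WithLp.toLp 2 x) (WithLp.toLp 2 y) := by
  simp [l2Dist, EuclideanSpace.dist_eq, Real.dist_eq, sq_abs]

lemma l2Dist_comm (x y : Fin q → ℝ) : l2Dist x y = l2Dist y x := by
  simp only [l2Dist_eq_dist, dist_comm]

lemma l2Dist_triangle (x y z : Fin q → ℝ) : l2Dist x z ≤ l2Dist x y + l2Dist y z := by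
  simp only [l2Dist_eq_dist]
  exact dist_triangle _ _ _

lemma l2Dist_nonneg (x y : Fin q → ℝ) : 0 ≤ l2Dist x y := Real.sqrt_nonneg _

lemma l2Dist_sq (x y : Fin q → ℝ) : l2Dist x y ^ 2 = ∑ i, (x i - y i) ^ 2 :=
  Real.sq_sqrt (Finset.sum_nonneg fun _ _ => sq_nonneg _)

lemma abs_sub_le_l2Dist (x y : Fin q → ℝ) (i : Fin q) : |x i - y i| ≤ l2Dist x y :=
  Real.abs_le_sqrt (Finset.single_le_sum (f := fun i => (x i - y i) ^ 2)
    (fun _ _ => sq_nonneg _) (Finset.mem_univ i))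

lemma continuous_l2Dist (y : Fin q → ℝ) : Continuous fun u => l2Dist u y := by
  unfold l2Dist; fun_prop

end Distance

section Bounds

variable {q : ℕ} [NeZero q]

lemma dualEnergy_lower_bound {β : ℝ} (hβ : 0 < β) (h m : ℝ) :
    ∃ R : ℝ, ∀ u : Fin q → ℝ, R ≤ ∑ i, u i ^ 2 →
      β / 8 * (1 + ∑ i, u i ^ 2) ≤ dualEnergy β h u - m := by
  set K := logSumExp (0 : Fin q → ℝ) + |h| + q * β + m
  refine ⟨8 / β * (K + β / 8), fun u hu => ?_⟩
  have h1 := (abs_le.1 (abs_logSumExp_sub_le (0 : Fin q → ℝ) (meanField β h u))).2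
  have h2 : ∑ i, |meanField β h u i - (0 : Fin q → ℝ) i| ≤
      β / 4 * ∑ i, u i ^ 2 + q * β + |h| := by
    calc _ ≤ ∑ i, (β / 4 * u i ^ 2 + β + if i = 0 then |h| else 0) := by
            refine Finset.sum_le_sum fun i _ => ?_
            rw [meanField, Pi.zero_apply, sub_zero]
            refine (abs_add_le _ _).trans (add_le_add ?_ (by split_ifs <;> simp))
            rw [abs_mul, abs_of_pos hβ, ← sq_abs (u i)]
            nlinarith [mul_nonneg hβ.le (sq_nonneg (|u i| - 2))]
      _ = _ := by
            rw [Finset.sum_add_distrib, Finset.sum_add_distrib, ← Finset.mul_sum]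
            simp
  have h3 : K + β / 8 ≤ β / 8 * ∑ i, u i ^ 2 := by
    have := mul_le_mul_of_nonneg_left hu (by positivity : 0 ≤ β / 8)
    rwa [← mul_assoc, show β / 8 * (8 / β) = 1 by field_simp, one_mul] at this
  simp only [dualEnergy]
  simp only [K] at h3
  linarith

lemma dualEnergy_local_bound {β h : ℝ} (hβ : 0 < β) {y : Fin q → ℝ} (hy : y ∈ minimizers q β h)
    {c : ℝ} (hc : 0 < c) (hcv : ∀ v, c * ∑ i, v i ^ 2 ≤ hessForm β y v) :
    ∀ᶠ r in 𝓝[>] (0 : ℝ), ∀ u, l2Dist u y < r →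
      c / 4 * ∑ i, (u i - y i) ^ 2 ≤ dualEnergy β h u - dualEnergy β h y := by
  have e1 : ∀ᶠ r in 𝓝[>] (0 : ℝ), r < 1 / (4 * β) :=
    nhdsWithin_le_nhds (eventually_lt_nhds (by positivity))
  have e2 : ∀ᶠ r in 𝓝[>] (0 : ℝ), r < c / (80 * β ^ 3) :=
    nhdsWithin_le_nhds (eventually_lt_nhds (by positivity))
  filter_upwards [e1, e2] with r hr1 hr2 u hu
  set M := l2Dist u y
  have hM0 : 0 ≤ M := l2Dist_nonneg u y
  have hM1 : β * M ≤ 1 / 4 := by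
    have := hu.le.trans hr1.le
    rw [le_div_iff₀ (by positivity)] at this
    linarith
  have hM2 : 20 * (β * M) ^ 3 ≤ c / 4 * M ^ 2 := by
    have := hu.le.trans hr2.le
    rw [le_div_iff₀ (by positivity)] at this
    nlinarith [mul_nonneg (sq_nonneg M) (sub_nonneg.2 this)]
  have h1 := (abs_le.1 (dualEnergy_add_expansion hβ.le hy (u - y) hM1
    (fun i => abs_sub_le_l2Dist u y i))).1
  have h2 := hcv (u - y)
  have h3 := l2Dist_sq u y
  rw [add_sub_cancel] at h1
  simp only [Pi.sub_apply] at h2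
  rw [← h3] at h2 ⊢
  linarith

lemma dualEnergy_global_bound {β h : ℝ} (hβ : 0 < β) {x : Fin q → ℝ}
    (hx : x ∈ minimizers q β h) {r : ℝ} (hr : 0 < r) :
    ∃ c > 0, ∀ u, (∀ y ∈ minimizers q β h, r ≤ l2Dist u y) →
      c * (1 + ∑ i, u i ^ 2) ≤ dualEnergy β h u - dualEnergy β h x := by
  obtain ⟨R, hR⟩ := dualEnergy_lower_bound (q := q) hβ h (dualEnergy β h x)
  set S : Set (Fin q → ℝ) := {u | ∑ i, u i ^ 2 ≤ R} ∩ {u | ∀ y ∈ minimizers q β h, r ≤ l2Dist u y}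
  have hS : IsCompact S := by
    have hcl : IsClosed S := by
      refine IsClosed.inter (isClosed_le (by fun_prop) continuous_const) ?_
      simp only [Set.ofPred_forall]
      exact isClosed_biInter fun y _ => isClosed_le continuous_const (continuous_l2Dist y)
    refine Metric.isCompact_of_isClosed_isBounded hcl
      ((Metric.isBounded_closedBall (x := (0 : Fin q → ℝ)) (r := √R)).subset fun u hu => ?_)
    rw [mem_closedBall_zero_iff, pi_norm_le_iff_of_nonneg (Real.sqrt_nonneg _)]
    exact fun i => Real.abs_le_sqrt ((Finset.single_le_sum (f := fun i => u i ^ 2)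
      (fun _ _ => sq_nonneg _) (Finset.mem_univ i)).trans hu.1)
  have hpos : ∀ u : Fin q → ℝ, 0 < 1 + ∑ i, u i ^ 2 := fun u => by positivity
  obtain ⟨c, hc, hcS⟩ : ∃ c > 0, ∀ u ∈ S,
      c * (1 + ∑ i, u i ^ 2) ≤ dualEnergy β h u - dualEnergy β h x := by
    rcases S.eq_empty_or_nonempty with h0 | h0
    · exact ⟨1, one_pos, by simp [h0]⟩
    · have hcont : Continuous fun u : Fin q → ℝ =>
          (dualEnergy β h u - dualEnergy β h x) / (1 + ∑ i, u i ^ 2) :=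
        ((continuous_dualEnergy β h).sub continuous_const).div (by fun_prop)
          fun u => (hpos u).ne'
      obtain ⟨w, hw, hmin⟩ := hS.exists_isMinOn h0 hcont.continuousOn
      refine ⟨_, div_pos (sub_pos.2 ?_) (hpos w), fun u hu => (le_div_iff₀ (hpos u)).1 (hmin hu)⟩
      by_contra! hle
      rw [dualEnergy_eq_freeEnergy hβ.le hx] at hle
      have := hw.2 w (mem_minimizers_of_dualEnergy_le hβ hx hle)
      have : r ≤ 0 := by simpa [l2Dist] using this
      linarith
  refine ⟨min c (β / 8), lt_min hc (by positivity), fun u hu => ?_⟩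
  rcases le_total (∑ i, u i ^ 2) R with h1 | h1
  · exact (mul_le_mul_of_nonneg_right (min_le_left _ _) (hpos u).le).trans (hcS u ⟨h1, hu⟩)
  · exact (mul_le_mul_of_nonneg_right (min_le_right _ _) (hpos u).le).trans (hR u h1)

end Bounds

section Perturbation

variable {q : ℕ} [NeZero q] {β h lam nu : ℝ} {βseq hseq : ℕ → ℝ}

lemma meanField_sub (β h β' h' : ℝ) (u : Fin q → ℝ) (i : Fin q) :
    meanField β' h' u i - meanField β h u i = (β' - β) * u i + if i = 0 then h' - h else 0 := by
  simp only [meanField]; split_ifs <;> ring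

lemma perturbation_bound
    (hβs : Tendsto (fun n : ℕ => (n : ℝ) * (βseq n - β)) atTop (𝓝 lam))
    (hhs : Tendsto (fun n : ℕ => (n : ℝ) * (hseq n - h)) atTop (𝓝 nu)) :
    ∃ C > 0, ∀ᶠ n : ℕ in atTop, ∀ u : Fin q → ℝ,
      |(n : ℝ) * (dualEnergy (βseq n) (hseq n) u - dualEnergy β h u)| ≤
        C * (1 + ∑ i, u i ^ 2) := by
  set B := |lam| + |nu| + 1
  have hB : 0 < B := by positivity
  have b1 : ∀ᶠ n : ℕ in atTop, |(n : ℝ) * (βseq n - β)| < B :=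
    hβs.abs.eventually_lt_const (by simp only [B]; linarith [abs_nonneg nu])
  have b2 : ∀ᶠ n : ℕ in atTop, |(n : ℝ) * (hseq n - h)| < B :=
    hhs.abs.eventually_lt_const (by simp only [B]; linarith [abs_nonneg lam])
  refine ⟨B * (q + 2), by positivity, ?_⟩
  filter_upwards [b1, b2] with n h1 h2 u
  have key := abs_logSumExp_sub_le (meanField β h u) (meanField (βseq n) (hseq n) u)
  have hs : (n : ℝ) * ∑ i, |meanField (βseq n) (hseq n) u i - meanField β h u i| ≤
      B * (∑ i, u i ^ 2) + q * B + B := by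
    rw [Finset.mul_sum]
    calc _ ≤ ∑ i, (B * u i ^ 2 + B + if i = 0 then B else 0) := by
            refine Finset.sum_le_sum fun i _ => ?_
            rw [meanField_sub, ← Nat.abs_cast n, ← abs_mul, mul_add, ← mul_assoc]
            refine (abs_add_le _ _).trans (add_le_add ?_ ?_)
            · rw [abs_mul]
              refine (mul_le_mul_of_nonneg_right h1.le (abs_nonneg _)).trans ?_
              rw [← sq_abs (u i)]
              nlinarith [mul_nonneg hB.le (sq_nonneg (|u i| - 1)), abs_nonneg (u i),
                mul_nonneg hB.le (sq_nonneg (|u i|))]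
            · split_ifs
              · exact h2.le
              · simp
      _ = _ := by
            rw [Finset.sum_add_distrib, Finset.sum_add_distrib, ← Finset.mul_sum]
            simp
  have e : (n : ℝ) * (dualEnergy (βseq n) (hseq n) u - dualEnergy β h u) =
      (n : ℝ) * (βseq n - β) * (∑ i, u i ^ 2) / 2 - n * (logSumExp (meanField (βseq n) (hseq n) u) -
        logSumExp (meanField β h u)) := by
    simp only [dualEnergy]; ring
  have hS : 0 ≤ ∑ i, u i ^ 2 := Finset.sum_nonneg fun _ _ => sq_nonneg _
  rw [e]
  refine (abs_sub _ _).trans ?_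
  rw [abs_div, abs_mul _ (∑ i, u i ^ 2), abs_of_nonneg hS,
    abs_mul (n : ℝ) (logSumExp _ - logSumExp _), Nat.abs_cast, abs_two]
  have t1 := mul_le_mul_of_nonneg_right h1.le hS
  have t2 := (mul_le_mul_of_nonneg_left key (Nat.cast_nonneg (α := ℝ) n)).trans hs
  have t3 : 0 ≤ (q : ℝ) * B * ∑ i, u i ^ 2 := by positivity
  have t4 : 0 ≤ B * ∑ i, u i ^ 2 := by positivity
  nlinarith

lemma tendsto_perturbation (hβ : 0 ≤ β)
    (hβs : Tendsto (fun n : ℕ => (n : ℝ) * (βseq n - β)) atTop (𝓝 lam))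
    (hhs : Tendsto (fun n : ℕ => (n : ℝ) * (hseq n - h)) atTop (𝓝 nu))
    (hβ' : Tendsto βseq atTop (𝓝 β)) (hh' : Tendsto hseq atTop (𝓝 h))
    {y : Fin q → ℝ} (hy : y ∈ minimizers q β h) {u : ℕ → Fin q → ℝ}
    (hu : Tendsto u atTop (𝓝 y)) :
    Tendsto (fun n : ℕ => (n : ℝ) * (dualEnergy (βseq n) (hseq n) (u n) - dualEnergy β h (u n)))
      atTop (𝓝 (-(lam / 2 * ∑ i, y i ^ 2 + nu * y 0))) := by
  have hui : ∀ i, Tendsto (fun n => u n i) atTop (𝓝 (y i)) := fun i => tendsto_pi_nhds.1 hu i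
  have hd : ∀ i, Tendsto (fun n : ℕ => (n : ℝ) * (meanField (βseq n) (hseq n) (u n) i -
      meanField β h (u n) i)) atTop (𝓝 (lam * y i + if i = 0 then nu else 0)) := by
    intro i
    simp only [meanField_sub, mul_add, ← mul_assoc]
    refine (hβs.mul (hui i)).add ?_
    split_ifs
    · exact hhs
    · simp
  have m1 : Tendsto (fun n => meanField β h (u n)) atTop (𝓝 (meanField β h y)) :=
    ((continuous_meanField β h).tendsto y).comp hu
  have m2 : Tendsto (fun n => meanField (βseq n) (hseq n) (u n)) atTop (𝓝 (meanField β h y)) := by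
    refine tendsto_pi_nhds.2 fun i => ?_
    simp only [meanField]
    refine (hβ'.mul (hui i)).add ?_
    split_ifs
    · exact hh'
    · simp
  have hsm : ∀ i, softmax (meanField β h y) i = y i := fun i =>
    (congrFun (minimizer_eq_softmax hβ hy) i).symm
  have hlim : ∑ i, y i * (lam * y i + if i = 0 then nu else 0) =
      lam * ∑ i, y i ^ 2 + nu * y 0 := by
    simp only [mul_add, Finset.sum_add_distrib, mul_ite, mul_zero, Finset.sum_ite_eq',
      Finset.mem_univ, if_true, Finset.mul_sum]
    rw [mul_comm nu]
    congr 1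
    exact Finset.sum_congr rfl fun i _ => by ring
  have side : ∀ w : ℕ → Fin q → ℝ, Tendsto w atTop (𝓝 (meanField β h y)) →
      Tendsto (fun n : ℕ => ∑ i, softmax (w n) i * ((n : ℝ) *
        (meanField (βseq n) (hseq n) (u n) i - meanField β h (u n) i))) atTop
        (𝓝 (lam * ∑ i, y i ^ 2 + nu * y 0)) := by
    intro w hw
    rw [← hlim]
    refine tendsto_finsetSum _ fun i _ => Tendsto.mul ?_ (hd i)
    rw [← hsm i]
    exact ((continuous_softmax i).tendsto _).comp hw
  have hmul : ∀ (n : ℕ) (p d : Fin q → ℝ),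
      ∑ i, p i * ((n : ℝ) * d i) = n * ∑ i, p i * d i := fun n p d => by
    rw [Finset.mul_sum]; exact Finset.sum_congr rfl fun i _ => by ring
  have hlse : Tendsto (fun n : ℕ => (n : ℝ) * (logSumExp (meanField (βseq n) (hseq n) (u n)) -
      logSumExp (meanField β h (u n)))) atTop (𝓝 (lam * ∑ i, y i ^ 2 + nu * y 0)) := by
    refine tendsto_of_tendsto_of_tendsto_of_le_of_le (side _ m1) (side _ m2) (fun n => ?_)
      fun n => ?_
    · dsimp only
      rw [hmul n _ (fun i => _)]
      exact mul_le_mul_of_nonneg_left (logSumExp_subgradient _ _) (Nat.cast_nonneg n)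
    · dsimp only
      rw [hmul n _ (fun i => _)]
      refine mul_le_mul_of_nonneg_left ?_ (Nat.cast_nonneg n)
      have := logSumExp_subgradient (meanField (βseq n) (hseq n) (u n)) (meanField β h (u n))
      have e : ∑ i, softmax (meanField (βseq n) (hseq n) (u n)) i *
          (meanField β h (u n) i - meanField (βseq n) (hseq n) (u n) i) =
          -∑ i, softmax (meanField (βseq n) (hseq n) (u n)) i *
          (meanField (βseq n) (hseq n) (u n) i - meanField β h (u n) i) := by
        rw [← Finset.sum_neg_distrib]; exact Finset.sum_congr rfl fun i _ => by ring
      linarith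
  have hsq : Tendsto (fun n => ∑ i, u n i ^ 2) atTop (𝓝 (∑ i, y i ^ 2)) :=
    tendsto_finsetSum _ fun i _ => (hui i).pow 2
  have := ((hβs.mul hsq).div_const 2).sub hlse
  convert this using 2
  · simp only [dualEnergy]; ring
  · ring

end Perturbation

section Laplace

lemma tendsto_of_tendsto_nat_mul_sub {a l : ℝ} {s : ℕ → ℝ}
    (hs : Tendsto (fun n : ℕ => (n : ℝ) * (s n - a)) atTop (𝓝 l)) : Tendsto s atTop (𝓝 a) := by
  have h1 := (hs.mul tendsto_inv_atTop_nhds_zero_nat).add_const a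
  rw [mul_zero, zero_add] at h1
  refine h1.congr' ?_
  filter_upwards [eventually_gt_atTop 0] with n hn
  have : (n : ℝ) ≠ 0 := by positivity
  field_simp
  ring

variable {q : ℕ}

lemma measurableSet_l2Dist_lt (y : Fin q → ℝ) (r : ℝ) : MeasurableSet {u | l2Dist u y < r} :=
  (isOpen_lt (continuous_l2Dist y) continuous_const).measurableSet

lemma setIntegral_rescale (f : (Fin q → ℝ) → ℝ) {V : Set (Fin q → ℝ)} (hV : MeasurableSet V)
    (y : Fin q → ℝ) {s : ℝ} (hs : 0 < s) :
    ∫ u in V, s ^ q * f u = ∫ v, V.indicator f (y + s⁻¹ • v) := by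
  rw [Measure.integral_comp_smul volume (fun w => V.indicator f (y + w)) s⁻¹,
    integral_add_left_eq_self (fun w => V.indicator f w) y, integral_indicator hV,
    integral_const_mul, Module.finrank_fin_fun, inv_pow, inv_inv, abs_of_pos (by positivity),
    smul_eq_mul]

variable [NeZero q] {β h lam nu : ℝ} {βseq hseq : ℕ → ℝ}

lemma tendsto_laplace_local (hβ : 0 < β)
    (hβs : Tendsto (fun n : ℕ => (n : ℝ) * (βseq n - β)) atTop (𝓝 lam))
    (hhs : Tendsto (fun n : ℕ => (n : ℝ) * (hseq n - h)) atTop (𝓝 nu))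
    {y : Fin q → ℝ} (hy : y ∈ minimizers q β h)
    {c : ℝ} (hc : 0 < c) (hcv : ∀ v, c * ∑ i, v i ^ 2 ≤ hessForm β y v) :
    ∀ᶠ r in 𝓝[>] (0 : ℝ), Tendsto (fun n : ℕ => ∫ u in {u | l2Dist u y < r}, √(n : ℝ) ^ q *
        Real.exp (-(n * (dualEnergy (βseq n) (hseq n) u - dualEnergy β h y)))) atTop
      (𝓝 ((∫ v, Real.exp (-hessForm β y v / 2)) *
        Real.exp (lam / 2 * ∑ i, y i ^ 2 + nu * y 0))) := by
  filter_upwards [dualEnergy_local_bound hβ hy hc hcv, self_mem_nhdsWithin] with r hr hr0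
  obtain ⟨C, hC, hCn⟩ := perturbation_bound (q := q) hβs hhs
  set V : Set (Fin q → ℝ) := {u | l2Dist u y < r}
  set E : ℕ → (Fin q → ℝ) → ℝ := fun n u =>
    Real.exp (-(n * (dualEnergy (βseq n) (hseq n) u - dualEnergy β h y)))
  set C' := C * (1 + (2 * ∑ i, y i ^ 2 + 2 * r ^ 2))
  have hlim : Tendsto (fun n : ℕ => (√(n : ℝ))⁻¹) atTop (𝓝 0) :=
    tendsto_inv_atTop_zero.comp (Real.tendsto_sqrt_atTop.comp tendsto_natCast_atTop_atTop)
  have hEc : ∀ n, Measurable (E n) := fun n => by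
    have := continuous_dualEnergy (q := q) (βseq n) (hseq n)
    exact Continuous.measurable (by fun_prop)
  have hdct : Tendsto (fun n : ℕ => ∫ v, V.indicator (E n) (y + (√(n : ℝ))⁻¹ • v)) atTop
      (𝓝 (∫ v, Real.exp (-hessForm β y v / 2) *
        Real.exp (lam / 2 * ∑ i, y i ^ 2 + nu * y 0))) := by
    refine tendsto_integral_filter_of_dominated_convergence
      (fun v => Real.exp C' * Real.exp (-(c / 4) * ∑ i, v i ^ 2)) ?_ ?_
      ((integrable_exp_neg_mul_sum_sq (by positivity)).const_mul _) ?_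
    · exact Eventually.of_forall fun n =>
        (((hEc n).indicator (measurableSet_l2Dist_lt y r)).comp (by fun_prop)).aestronglyMeasurable
    · filter_upwards [hCn, eventually_gt_atTop 0] with n hn hn0
      refine Eventually.of_forall fun v => ?_
      rw [← Real.exp_add]
      by_cases hv : y + (√(n : ℝ))⁻¹ • v ∈ V
      · rw [Set.indicator_of_mem hv, Real.norm_eq_abs, Real.abs_exp, Real.exp_le_exp]
        set u := y + (√(n : ℝ))⁻¹ • v with hu
        have hnp : (0 : ℝ) < n := by exact_mod_cast hn0
        have h1 := hr u hv
        have h2 := (abs_le.1 (hn u)).1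
        have h3 : (n : ℝ) * ∑ i, (u i - y i) ^ 2 = ∑ i, v i ^ 2 := by
          rw [Finset.mul_sum]
          refine Finset.sum_congr rfl fun i _ => ?_
          simp only [hu, Pi.add_apply, Pi.smul_apply, smul_eq_mul, add_sub_cancel_left, mul_pow,
            inv_pow, Real.sq_sqrt hnp.le]
          field_simp
        have h4 : ∑ i, u i ^ 2 ≤ 2 * ∑ i, y i ^ 2 + 2 * r ^ 2 := by
          have hd : ∑ i, (u i - y i) ^ 2 ≤ r ^ 2 := by
            rw [← l2Dist_sq]
            exact pow_le_pow_left₀ (l2Dist_nonneg _ _) (le_of_lt hv) 2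
          have : ∑ i, u i ^ 2 ≤ ∑ i, (2 * y i ^ 2 + 2 * (u i - y i) ^ 2) :=
            Finset.sum_le_sum fun i _ => by nlinarith [sq_nonneg (u i - 2 * y i)]
          rw [Finset.sum_add_distrib, ← Finset.mul_sum, ← Finset.mul_sum] at this
          linarith
        have h5 : C * (1 + ∑ i, u i ^ 2) ≤ C' :=
          mul_le_mul_of_nonneg_left (by linarith) hC.le
        have h6 := mul_le_mul_of_nonneg_left h1 hnp.le
        have h7 : (n : ℝ) * (c / 4 * ∑ i, (u i - y i) ^ 2) = c / 4 * ∑ i, v i ^ 2 := by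
          rw [← h3]; ring
        rw [h7] at h6
        linarith
      · rw [Set.indicator_of_notMem hv, norm_zero]
        exact (Real.exp_pos _).le
    · refine Eventually.of_forall fun v => ?_
      have hu : Tendsto (fun n : ℕ => y + (√(n : ℝ))⁻¹ • v) atTop (𝓝 y) := by
        have := (hlim.smul_const v).const_add y
        rwa [zero_smul, add_zero] at this
      have hV : ∀ᶠ n : ℕ in atTop, y + (√(n : ℝ))⁻¹ • v ∈ V := by
        refine hu.eventually ((isOpen_lt (continuous_l2Dist y) continuous_const).mem_nhds ?_)
        simpa [l2Dist] using hr0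
      have t1 := tendsto_perturbation hβ.le hβs hhs (tendsto_of_tendsto_nat_mul_sub hβs)
        (tendsto_of_tendsto_nat_mul_sub hhs) hy hu
      have hne : ∀ᶠ n : ℕ in atTop, (√(n : ℝ))⁻¹ ≠ 0 := by
        filter_upwards [eventually_gt_atTop 0] with n hn
        positivity
      have t2 := tendsto_dualEnergy_scaled hβ.le hy v hlim hne
      rw [← Real.exp_add]
      have t3 := (Real.continuous_exp.tendsto _).comp (t1.add t2).neg
      rw [show -hessForm β y v / 2 + (lam / 2 * ∑ i, y i ^ 2 + nu * y 0) =
        -(-(lam / 2 * ∑ i, y i ^ 2 + nu * y 0) + hessForm β y v / 2) by ring]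
      refine t3.congr' ?_
      filter_upwards [hV, eventually_gt_atTop 0] with n hn hn0
      have hnp : (0 : ℝ) < n := by exact_mod_cast hn0
      rw [Set.indicator_of_mem hn]
      simp only [Function.comp, E]
      rw [inv_pow, Real.sq_sqrt hnp.le, div_inv_eq_mul]
      congr 1
      ring
  rw [integral_mul_const] at hdct
  refine hdct.congr' ?_
  filter_upwards [eventually_gt_atTop 0] with n hn
  exact (setIntegral_rescale (E n) (measurableSet_l2Dist_lt y r) y (by positivity)).symm

lemma tendsto_laplace_outside (hβ : 0 < β)
    (hβs : Tendsto (fun n : ℕ => (n : ℝ) * (βseq n - β)) atTop (𝓝 lam))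
    (hhs : Tendsto (fun n : ℕ => (n : ℝ) * (hseq n - h)) atTop (𝓝 nu))
    {x : Fin q → ℝ} (hx : x ∈ minimizers q β h) {r : ℝ} (hr : 0 < r) :
    Tendsto (fun n : ℕ => ∫ u in {u | ∀ y ∈ minimizers q β h, r ≤ l2Dist u y}, √(n : ℝ) ^ q *
        Real.exp (-(n * (dualEnergy (βseq n) (hseq n) u - dualEnergy β h x)))) atTop (𝓝 0) := by
  obtain ⟨C, hC, hCn⟩ := perturbation_bound (q := q) hβs hhs
  obtain ⟨c, hc, hcu⟩ := dualEnergy_global_bound hβ hx hr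
  set O : Set (Fin q → ℝ) := {u | ∀ y ∈ minimizers q β h, r ≤ l2Dist u y}
  have hO : MeasurableSet O := by
    have : IsClosed O := by
      simp only [O, Set.ofPred_forall]
      exact isClosed_biInter fun y _ => isClosed_le continuous_const (continuous_l2Dist y)
    exact this.measurableSet
  have hbound : Tendsto (fun n : ℕ => Real.exp (-(c / 2) * n) * √(2 * π / c) ^ q) atTop (𝓝 0) := by
    rw [← zero_mul (√(2 * π / c) ^ q)]
    refine Tendsto.mul_const _ (Real.tendsto_exp_atBot.comp ?_)
    exact (tendsto_natCast_atTop_atTop).const_mul_atTop_of_neg (by linarith)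
  refine squeeze_zero' (Eventually.of_forall fun n => integral_nonneg fun u => by positivity) ?_
    hbound
  have hlarge : ∀ᶠ n : ℕ in atTop, 2 * C / c ≤ n :=
    tendsto_natCast_atTop_atTop.eventually_ge_atTop _
  filter_upwards [hCn, hlarge, eventually_gt_atTop 0] with n hn hl hn0
  have hnp : (0 : ℝ) < n := by exact_mod_cast hn0
  have hb : 0 < c / 2 * n := by positivity
  have hl' : C ≤ c / 2 * n := by
    rw [div_le_iff₀ hc] at hl; linarith
  set g : (Fin q → ℝ) → ℝ := fun u => √(n : ℝ) ^ q *
    (Real.exp (-(c / 2) * n) * Real.exp (-(c / 2 * n) * ∑ i, u i ^ 2))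
  have hg : Integrable g := ((integrable_exp_neg_mul_sum_sq hb).const_mul _).const_mul _
  calc _ ≤ ∫ u in O, g u := by
          refine integral_mono_of_nonneg (Eventually.of_forall fun u => by positivity)
            hg.integrableOn ?_
          filter_upwards [ae_restrict_mem hO] with u hu
          refine mul_le_mul_of_nonneg_left ?_ (by positivity)
          rw [← Real.exp_add, Real.exp_le_exp]
          have h1 := mul_le_mul_of_nonneg_left (hcu u hu) hnp.le
          have h2 := (abs_le.1 (hn u)).1
          have h3 := mul_le_mul_of_nonneg_right hl'
            (by positivity : 0 ≤ 1 + ∑ i, u i ^ 2)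
          nlinarith
    _ ≤ ∫ u, g u := setIntegral_le_integral hg (Eventually.of_forall fun u => by positivity)
    _ = _ := by
          simp only [g]
          rw [integral_const_mul, integral_const_mul, integral_exp_neg_mul_sum_sq,
            Fintype.card_fin, mul_left_comm, ← mul_pow, ← Real.sqrt_mul hnp.le]
          congr 3
          field_simp

end Laplace

section HubbardStratonovich

variable {q n : ℕ}

lemma sum_colorCount_mul (σ : Fin n → Fin q) (g : Fin q → ℝ) :
    ∑ k, (colorCount σ k : ℝ) * g k = ∑ i, g (σ i) := by
  rw [← Finset.sum_fiberwise (s := Finset.univ) (g := σ)]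
  refine Finset.sum_congr rfl fun k _ => ?_
  rw [Finset.sum_congr rfl (g := fun _ => g k) (fun i hi => by rw [(Finset.mem_filter.1 hi).2])]
  simp [colorCount]

lemma sum_colorCount_sq (σ : Fin n → Fin q) :
    ∑ k, (colorCount σ k : ℝ) ^ 2 =
      n + 2 * ∑ p ∈ Finset.univ.filter (fun p : Fin n × Fin n => p.1 < p.2),
        (if σ p.1 = σ p.2 then (1 : ℝ) else 0) := by
  set d : Fin n × Fin n → ℝ := fun p => if σ p.1 = σ p.2 then 1 else 0
  have h1 : ∑ k, (colorCount σ k : ℝ) ^ 2 = ∑ p, d p := by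
    simp only [pow_two]
    rw [sum_colorCount_mul σ fun k => (colorCount σ k : ℝ), Fintype.sum_prod_type]
    refine Finset.sum_congr rfl fun i _ => ?_
    simp [d, colorCount, eq_comm]
  have h2 : ∑ p, d p = ∑ p ∈ univ.filter (fun p : Fin n × Fin n => p.1 < p.2), d p +
      (∑ p ∈ univ.filter (fun p : Fin n × Fin n => p.2 < p.1), d p +
        ∑ p ∈ univ.filter (fun p : Fin n × Fin n => p.1 = p.2), d p) := by
    simp only [Finset.sum_filter, ← Finset.sum_add_distrib]
    refine Finset.sum_congr rfl fun p _ => ?_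
    rcases lt_trichotomy p.1 p.2 with h | h | h
    · simp [h, h.not_gt, h.ne]
    · simp [h]
    · simp [h, h.not_gt, h.ne']
  have h3 : ∑ p ∈ univ.filter (fun p : Fin n × Fin n => p.2 < p.1), d p =
      ∑ p ∈ univ.filter (fun p : Fin n × Fin n => p.1 < p.2), d p :=
    Finset.sum_nbij' Prod.swap Prod.swap (by simp) (by simp) (by simp) (by simp)
      (by simp [d, eq_comm])
  have h4 : ∑ p ∈ univ.filter (fun p : Fin n × Fin n => p.1 = p.2), d p = n := by
    rw [Finset.sum_filter, Fintype.sum_prod_type]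
    simp [d]
  rw [h1, h2, h3, h4]
  ring

variable [NeZero q]

/-- The joint density of the spins and the auxiliary Gaussian field. -/
noncomputable def hsKernel (β h : ℝ) (σ : Fin n → Fin q) (u : Fin q → ℝ) : ℝ :=
  Real.exp (-(n * β / 2) * ∑ i, u i ^ 2 + ∑ k, (colorCount σ k : ℝ) * meanField β h u k)

lemma sum_hsKernel (β h : ℝ) (u : Fin q → ℝ) :
    ∑ σ : Fin n → Fin q, hsKernel β h σ u = Real.exp (-(n * dualEnergy β h u)) := by
  have h1 : -(n * dualEnergy β h u) =
      -(n * β / 2) * ∑ i, u i ^ 2 + n * logSumExp (meanField β h u) := by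
    rw [dualEnergy]; ring
  simp only [hsKernel, Real.exp_add, sum_colorCount_mul, Real.exp_sum, h1]
  rw [← Finset.mul_sum, Real.exp_nat_mul, exp_logSumExp, Fintype.sum_pow]

lemma hsKernel_eq (hn : n ≠ 0) (β h : ℝ) (σ : Fin n → Fin q) (u : Fin q → ℝ) :
    hsKernel β h σ u =
      Real.exp (β / (2 * n) * ∑ k, (colorCount σ k : ℝ) ^ 2 + h * colorCount σ 0) *
        Real.exp (-(n * β / 2) * ∑ i, (u i - colorCount σ i / n) ^ 2) := by
  have hn' : (n : ℝ) ≠ 0 := by exact_mod_cast hn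
  rw [hsKernel, ← Real.exp_add, sum_mul_meanField β h (fun k => (colorCount σ k : ℝ)) u]
  congr 1
  have : -(n * β / 2) * ∑ i, (u i - colorCount σ i / n) ^ 2 = -(n * β / 2) * ∑ i, u i ^ 2 +
      β * ∑ i, (colorCount σ i : ℝ) * u i - β / (2 * n) * ∑ k, (colorCount σ k : ℝ) ^ 2 := by
    simp only [Finset.mul_sum, ← Finset.sum_add_distrib, ← Finset.sum_sub_distrib]
    refine Finset.sum_congr rfl fun i _ => ?_
    field_simp
    ring
  rw [this]; ring

omit [NeZero q] in
lemma integrable_exp_neg_mul_sum_sub_sq {b : ℝ} (hb : 0 < b) (w : Fin q → ℝ) :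
    Integrable fun u : Fin q → ℝ => Real.exp (-b * ∑ i, (u i - w i) ^ 2) :=
  (integrable_exp_neg_mul_sum_sq (ι := Fin q) hb).comp_sub_right w

omit [NeZero q] in
lemma integral_exp_neg_mul_sum_sub_sq (b : ℝ) (w : Fin q → ℝ) :
    ∫ u : Fin q → ℝ, Real.exp (-b * ∑ i, (u i - w i) ^ 2) = √(π / b) ^ q := by
  have := integral_sub_right_eq_self (μ := volume)
    (fun u : Fin q → ℝ => Real.exp (-b * ∑ i, u i ^ 2)) w
  simp only [Pi.sub_apply] at this
  rw [this, integral_exp_neg_mul_sum_sq, Fintype.card_fin]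

lemma integrable_hsKernel (hn : n ≠ 0) {β : ℝ} (hβ : 0 < β) (h : ℝ) (σ : Fin n → Fin q) :
    Integrable (hsKernel β h σ) := by
  rw [show hsKernel β h σ = _ from funext (hsKernel_eq hn β h σ)]
  exact (integrable_exp_neg_mul_sum_sub_sq (by positivity) fun i =>
    (colorCount σ i : ℝ) / n).const_mul _

lemma integral_hsKernel (hn : n ≠ 0) (β h : ℝ) (σ : Fin n → Fin q) :
    ∫ u, hsKernel β h σ u =
      √(π / (n * β / 2)) ^ q * Real.exp (β / 2) * cwWeight q n β h σ := by
  have hn' : (n : ℝ) ≠ 0 := by exact_mod_cast hn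
  simp only [hsKernel_eq hn]
  rw [integral_const_mul, integral_exp_neg_mul_sum_sub_sq _ fun i => (colorCount σ i : ℝ) / n,
    mul_comm, mul_assoc]
  congr 1
  rw [cwWeight, ← Real.exp_add, sum_colorCount_sq]
  congr 1
  have : ∑ i, (if σ i = 0 then (1 : ℝ) else 0) = colorCount σ 0 := by simp [colorCount]
  rw [this]
  field_simp
  ring

lemma setIntegral_hsKernel_le (hn : n ≠ 0) {β : ℝ} (hβ : 0 < β) (h : ℝ) (σ : Fin n → Fin q)
    {E : Set (Fin q → ℝ)} (hE : MeasurableSet E) {δ : ℝ} (hδ : 0 ≤ δ)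
    (hd : ∀ u ∈ E, δ ≤ l2Dist u fun i => (colorCount σ i : ℝ) / n) :
    ∫ u in E, hsKernel β h σ u ≤
      Real.exp (-(n * β / 4) * δ ^ 2) * √2 ^ q * ∫ u, hsKernel β h σ u := by
  have hnp : (0 : ℝ) < n := by positivity
  simp only [hsKernel_eq hn]
  set W := Real.exp (β / (2 * n) * ∑ k, (colorCount σ k : ℝ) ^ 2 + h * colorCount σ 0)
  set w : Fin q → ℝ := fun i => (colorCount σ i : ℝ) / n
  set g : (Fin q → ℝ) → ℝ := fun u => W * (Real.exp (-(n * β / 4) * δ ^ 2) *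
    Real.exp (-(n * β / 4) * ∑ i, (u i - w i) ^ 2))
  have hg : Integrable g :=
    ((integrable_exp_neg_mul_sum_sub_sq (by positivity) w).const_mul _).const_mul _
  calc _ ≤ ∫ u in E, g u := by
          refine integral_mono_of_nonneg (Eventually.of_forall fun u => by positivity)
            hg.integrableOn ?_
          filter_upwards [ae_restrict_mem hE] with u hu
          refine mul_le_mul_of_nonneg_left ?_ (Real.exp_pos _).le
          rw [← Real.exp_add, Real.exp_le_exp]
          have h1 := pow_le_pow_left₀ hδ (hd u hu) 2
          rw [l2Dist_sq] at h1
          have h2 := mul_le_mul_of_nonneg_left h1 (by positivity : 0 ≤ (n : ℝ) * β / 4)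
          linarith
    _ ≤ ∫ u, g u := setIntegral_le_integral hg (Eventually.of_forall fun u => by positivity)
    _ = _ := by
          simp only [g]
          rw [integral_const_mul, integral_const_mul, integral_const_mul,
            integral_exp_neg_mul_sum_sub_sq _ w, integral_exp_neg_mul_sum_sub_sq _ w,
            show π / (n * β / 4) = 2 * (π / (n * β / 2)) by field_simp; norm_num,
            Real.sqrt_mul zero_le_two, mul_pow]
          ring

end HubbardStratonovich

section Coexistence

variable {q : ℕ} [NeZero q]

lemma abs_sum_indicator_sub_setIntegral_le {n : ℕ} (hn : n ≠ 0) {β : ℝ} (hβ : 0 < β) (h : ℝ)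
    (A : Set (Fin n → Fin q)) {V O : Set (Fin q → ℝ)} (hV : MeasurableSet V)
    (hO : MeasurableSet O) (hVO : Disjoint V O) {δ : ℝ} (hδ : 0 ≤ δ)
    (h1 : ∀ σ ∉ A, ∀ u ∈ V, δ ≤ l2Dist u fun i => (colorCount σ i : ℝ) / n)
    (h2 : ∀ σ ∈ A, ∀ u ∉ V, u ∉ O → δ ≤ l2Dist u fun i => (colorCount σ i : ℝ) / n) :
    |∑ σ, A.indicator (fun σ => ∫ u, hsKernel β h σ u) σ -
        ∫ u in V, Real.exp (-(n * dualEnergy β h u))| ≤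
      Real.exp (-(n * β / 4) * δ ^ 2) * √2 ^ q *
        (∫ u : Fin q → ℝ, Real.exp (-(n * dualEnergy β h u))) +
        ∫ u in O, Real.exp (-(n * dualEnergy β h u)) := by
  have hint := integrable_hsKernel (q := q) hn hβ h
  have hnn : ∀ (σ : Fin n → Fin q) u, 0 ≤ hsKernel β h σ u := fun σ u => (Real.exp_pos _).le
  simp only [← sum_hsKernel]
  rw [integral_finsetSum _ fun σ _ => (hint σ).integrableOn,
    integral_finsetSum _ fun σ _ => (hint σ).integrableOn,
    integral_finsetSum _ fun σ _ => hint σ, Finset.mul_sum, ← Finset.sum_sub_distrib,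
    ← Finset.sum_add_distrib]
  refine (Finset.abs_sum_le_sum_abs _ _).trans (Finset.sum_le_sum fun σ _ => ?_)
  have hO0 : 0 ≤ ∫ u in O, hsKernel β h σ u := integral_nonneg (hnn σ)
  have hV0 : 0 ≤ ∫ u in V, hsKernel β h σ u := integral_nonneg (hnn σ)
  by_cases hσ : σ ∈ A
  · rw [Set.indicator_of_mem hσ]
    have hW := setIntegral_hsKernel_le hn hβ h σ (hV.union hO).compl hδ fun u hu =>
      h2 σ hσ u (fun hu' => hu (Or.inl hu')) fun hu' => hu (Or.inr hu')
    have hW0 : 0 ≤ ∫ u in (V ∪ O)ᶜ, hsKernel β h σ u := integral_nonneg (hnn σ)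
    have e1 := integral_add_compl (hV.union hO) (hint σ)
    rw [setIntegral_union hVO hO (hint σ).integrableOn (hint σ).integrableOn] at e1
    rw [abs_le]
    constructor <;> linarith
  · rw [Set.indicator_of_notMem hσ, zero_sub, abs_neg, abs_of_nonneg hV0]
    have := setIntegral_hsKernel_le hn hβ h σ hV hδ (h1 σ hσ)
    linarith

lemma cwProb_eq_div {n : ℕ} (hn : n ≠ 0) {β : ℝ} (hβ : 0 < β) (h : ℝ) (A : Set (Fin n → Fin q)) :
    cwProb q n β h A = (∑ σ, A.indicator (fun σ => ∫ u, hsKernel β h σ u) σ) /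
      ∫ u : Fin q → ℝ, Real.exp (-(n * dualEnergy β h u)) := by
  have hc : √(π / (n * β / 2)) ^ q * Real.exp (β / 2) ≠ 0 := by positivity
  have hnum : ∑ σ, A.indicator (fun σ : Fin n → Fin q => ∫ u, hsKernel β h σ u) σ =
      √(π / (n * β / 2)) ^ q * Real.exp (β / 2) * ∑ σ, A.indicator (cwWeight q n β h) σ := by
    rw [Finset.mul_sum]
    refine Finset.sum_congr rfl fun σ _ => ?_
    by_cases hσ : σ ∈ A <;> simp [hσ, integral_hsKernel hn]
  simp only [← sum_hsKernel]
  rw [integral_finsetSum _ fun σ _ => integrable_hsKernel hn hβ h σ, hnum]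
  simp only [integral_hsKernel hn]
  rw [← Finset.mul_sum, mul_div_mul_left _ _ hc, cwProb, cwZ]

omit [NeZero q] in
lemma iInf_spike (hq : 2 ≤ q) (k : Fin q) {a b : ℝ} (hba : b ≤ a) : ⨅ i, spike k a b i = b := by
  have : Nontrivial (Fin q) := Fin.nontrivial_iff_two_le.2 hq
  obtain ⟨j, hj⟩ := exists_ne k
  refine le_antisymm ?_ (le_ciInf fun i => ?_)
  · exact (ciInf_le (Set.finite_range _).bddBelow j).trans (by simp [spike, hj])
  · simp only [spike]; split_ifs <;> linarith

variable {β h lam nu : ℝ} {βseq hseq : ℕ → ℝ}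

lemma exists_tendsto_laplace_local (hq : 2 ≤ q) (hβ : 0 < β) (hh : 0 ≤ h)
    (hβs : Tendsto (fun n : ℕ => (n : ℝ) * (βseq n - β)) atTop (𝓝 lam))
    (hhs : Tendsto (fun n : ℕ => (n : ℝ) * (hseq n - h)) atTop (𝓝 nu))
    {x x' : Fin q → ℝ} (hx : x ∈ minimizers q β h) (hx' : x' ∈ minimizers q β h) (hne : x' ≠ x) :
    ∃ κ > 0, ∀ y ∈ minimizers q β h, 0 < tauWeight q β lam nu y ∧
      ∀ᶠ r in 𝓝[>] (0 : ℝ), Tendsto (fun n : ℕ => ∫ u in {u | l2Dist u y < r}, √(n : ℝ) ^ q *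
        Real.exp (-(n * (dualEnergy (βseq n) (hseq n) u - dualEnergy β h x)))) atTop
      (𝓝 (κ * tauWeight q β lam nu y)) := by
  obtain ⟨ρ, hρ, hst⟩ := coexistence_structure hq hβ hh hx hx' hne
  refine ⟨√(2 * π) ^ q / √(β ^ q * ρ), by positivity, fun y hy => ?_⟩
  obtain ⟨k, a, b, rfl, hba, hab, h1, h2⟩ := hst y hy
  have h1' : 0 < 1 - q * β * a * b := h1 ▸ hρ
  have hxy : dualEnergy β h (spike k a b) = dualEnergy β h x := by
    rw [dualEnergy_eq_freeEnergy hβ.le hx, dualEnergy_eq_freeEnergy hβ.le hy]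
    exact le_antisymm (hy.2 x hx.1) (hx.2 _ hy.1)
  obtain ⟨c, hc, hcv⟩ := hessForm_lower_bound hq hβ k hab h1' h2
  have hlap := tendsto_laplace_local hβ hβs hhs hy hc hcv
  rw [integral_exp_hessForm_spike hq hβ k hab h1' h2, hxy, h1] at hlap
  rw [tauWeight, iInf_spike hq k hba, ← mul_assoc]
  exact ⟨mul_pos (Real.rpow_pos_of_pos h2 _) (Real.exp_pos _), hlap⟩

omit [NeZero q] in
lemma integral_exp_scale (m : ℝ) {n : ℕ} (Φ : (Fin q → ℝ) → ℝ) (E : Set (Fin q → ℝ)) :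
    ∫ u in E, √(n : ℝ) ^ q * Real.exp (-(n * (Φ u - m))) =
      √(n : ℝ) ^ q * Real.exp (n * m) * ∫ u in E, Real.exp (-(n * Φ u)) := by
  rw [← integral_const_mul]
  refine integral_congr_ae (Eventually.of_forall fun u => ?_)
  dsimp only
  rw [mul_assoc, ← Real.exp_add]
  congr 2
  ring

theorem tendsto_cwProb_coexistence (hq : 2 ≤ q) (hβ : 0 < β) (hh : 0 ≤ h)
    (hβs : Tendsto (fun n : ℕ => (n : ℝ) * (βseq n - β)) atTop (𝓝 lam))
    (hhs : Tendsto (fun n : ℕ => (n : ℝ) * (hseq n - h)) atTop (𝓝 nu))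
    {x x' : Fin q → ℝ} (hx : x ∈ minimizers q β h) (hx' : x' ∈ minimizers q β h) (hne : x' ≠ x)
    (hfin : (minimizers q β h).Finite) {ε : ℝ} (hε : 0 < ε)
    (hsep : ∀ y ∈ minimizers q β h, ∀ y' ∈ minimizers q β h, y ≠ y' → ε < l2Dist y y') :
    Tendsto (fun n : ℕ => cwProb q n (βseq n) (hseq n)
        {σ | l2Dist (fun i => (colorCount σ i : ℝ) / n) x < ε}) atTop
      (𝓝 (tauWeight q β lam nu x / ∑ y ∈ hfin.toFinset, tauWeight q β lam nu y)) := by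
  obtain ⟨κ, hκ, hloc⟩ := exists_tendsto_laplace_local hq hβ hh hβs hhs hx hx' hne
  have e1 : ∀ᶠ r in 𝓝[>] (0 : ℝ), ∀ y ∈ minimizers q β h,
      Tendsto (fun n : ℕ => ∫ u in {u | l2Dist u y < r}, √(n : ℝ) ^ q *
        Real.exp (-(n * (dualEnergy (βseq n) (hseq n) u - dualEnergy β h x)))) atTop
      (𝓝 (κ * tauWeight q β lam nu y)) :=
    (eventually_all_finite hfin).2 fun y hy => (hloc y hy).2
  have e2 : ∀ᶠ r in 𝓝[>] (0 : ℝ), ∀ y ∈ minimizers q β h, x ≠ y → r < (l2Dist x y - ε) / 2 := by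
    refine (eventually_all_finite hfin).2 fun y hy => ?_
    rcases eq_or_ne x y with rfl | hxy
    · simp
    · have : 0 < (l2Dist x y - ε) / 2 := by linarith [hsep x hx y hy hxy]
      filter_upwards [nhdsWithin_le_nhds (eventually_lt_nhds this)] with r hr _ using hr
  have e3 : ∀ᶠ r in 𝓝[>] (0 : ℝ), r < ε / 2 :=
    nhdsWithin_le_nhds (eventually_lt_nhds (by positivity))
  obtain ⟨r, hr1, hr2, hr3, hr0⟩ := (e1.and (e2.and (e3.and self_mem_nhdsWithin))).exists
  replace hr0 : 0 < r := hr0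
  set V : (Fin q → ℝ) → Set (Fin q → ℝ) := fun y => {u | l2Dist u y < r} with hVdef
  set O : Set (Fin q → ℝ) := {u | ∀ y ∈ minimizers q β h, r ≤ l2Dist u y} with hOdef
  have hV : ∀ y, MeasurableSet (V y) := fun y => measurableSet_l2Dist_lt y r
  have hcompl : (⋃ y ∈ hfin.toFinset, V y)ᶜ = O := by
    ext u; simp [hVdef, hOdef]
  have hUm : MeasurableSet (⋃ y ∈ hfin.toFinset, V y) := 
    Finset.measurableSet_biUnion _ fun y _ => hV y
  have hO : MeasurableSet O := hcompl ▸ hUm.compl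
  have hdisj : Set.PairwiseDisjoint (↑hfin.toFinset) V := by
    intro y hy y' hy' hyy'
    refine Set.disjoint_left.2 fun u hu hu' => ?_
    have h1 := hsep y (by simpa using hy) y' (by simpa using hy') hyy'
    have h2 := l2Dist_triangle y u y'
    rw [l2Dist_comm y u] at h2
    have h3 : l2Dist u y < r := hu
    have h4 : l2Dist u y' < r := hu'
    linarith
  set m := dualEnergy β h x
  set T : ℕ → Set (Fin q → ℝ) → ℝ := fun n E => ∫ u in E, √(n : ℝ) ^ q *
        Real.exp (-(n * (dualEnergy (βseq n) (hseq n) u - m))) with hT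
  have hTO : Tendsto (fun n => T n O) atTop (𝓝 0) := tendsto_laplace_outside hβ hβs hhs hx hr0
  have hβlim := tendsto_of_tendsto_nat_mul_sub hβs
  have hgood : ∀ᶠ n : ℕ in atTop, n ≠ 0 ∧ 0 < βseq n :=
    (eventually_ne_atTop 0).and (hβlim.eventually_const_lt hβ)
  have hTuniv : Tendsto (fun n => T n Set.univ) atTop
      (𝓝 (κ * ∑ y ∈ hfin.toFinset, tauWeight q β lam nu y)) := by
    have hsum : Tendsto (fun n => ∑ y ∈ hfin.toFinset, T n (V y) + T n O) atTop
        (𝓝 (∑ y ∈ hfin.toFinset, κ * tauWeight q β lam nu y + 0)) :=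
      (tendsto_finsetSum _ fun y hy => hr1 y (by simpa using hy)).add hTO
    rw [add_zero, ← Finset.mul_sum] at hsum
    refine hsum.congr' ?_
    filter_upwards [hgood] with n hn
    have hi : Integrable fun u : Fin q → ℝ => √(n : ℝ) ^ q *
        Real.exp (-(n * (dualEnergy (βseq n) (hseq n) u - m))) := by
      have : Integrable fun u : Fin q → ℝ => √(n : ℝ) ^ q * Real.exp (n * m) *
          ∑ σ : Fin n → Fin q, hsKernel (βseq n) (hseq n) σ u :=
        (integrable_finsetSum _ fun σ _ => integrable_hsKernel hn.1 hn.2 (hseq n) σ).const_mul _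
      refine this.congr (Eventually.of_forall fun u => ?_)
      dsimp only
      rw [sum_hsKernel, mul_assoc, ← Real.exp_add]
      congr 2
      ring
    have h1 := integral_add_compl hUm hi
    rw [hcompl, integral_biUnion_finset _ (fun y _ => hV y) hdisj fun y _ => hi.integrableOn] at h1
    simp only [hT, setIntegral_univ]
    exact h1
  set η : ℕ → ℝ := fun n => Real.exp (-(n * βseq n / 4) * r ^ 2) * √2 ^ q
  have hη : Tendsto η atTop (𝓝 0) := by
    rw [← zero_mul (√2 ^ q)]
    refine Tendsto.mul_const _ (Real.tendsto_exp_atBot.comp ?_)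
    have : Tendsto (fun n : ℕ => -(r ^ 2 / 4) * ((n : ℝ) * βseq n)) atTop atBot :=
      (tendsto_natCast_atTop_atTop.atTop_mul_pos hβ hβlim).const_mul_atTop_of_neg
        (by nlinarith [pow_pos hr0 2])
    exact this.congr fun n => by ring
  set a : ℕ → ℝ := fun n => √(n : ℝ) ^ q * Real.exp (n * m) *
    ∑ σ : Fin n → Fin q, Set.indicator {σ | l2Dist (fun i => (colorCount σ i : ℝ) / n) x < ε}
      (fun σ => ∫ u, hsKernel (βseq n) (hseq n) σ u) σ with ha
  have hbound : ∀ᶠ n in atTop, |a n - T n (V x)| ≤ η n * T n Set.univ + T n O := by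
    filter_upwards [hgood] with n hn
    have hs : 0 ≤ √(n : ℝ) ^ q * Real.exp (n * m) := by positivity
    have key := abs_sum_indicator_sub_setIntegral_le hn.1 hn.2 (hseq n)
      {σ | l2Dist (fun i => (colorCount σ i : ℝ) / n) x < ε} (hV x) hO
      (Set.disjoint_left.2 fun u hu hu' => (not_lt.2 (hu' x hx)) hu) hr0.le
      (fun σ hσ u hu => by
        have h1 : ε ≤ l2Dist (fun i => (colorCount σ i : ℝ) / n) x := not_lt.1 hσ
        have h2 := l2Dist_triangle (fun i => (colorCount σ i : ℝ) / n) u x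
        rw [l2Dist_comm _ u] at h2
        have h3 : l2Dist u x < r := hu
        linarith)
      (fun σ hσ u hu hu' => by
        have h1 : l2Dist (fun i => (colorCount σ i : ℝ) / n) x < ε := hσ
        simp only [hOdef, Set.mem_ofPred_eq, not_forall, not_le] at hu'
        obtain ⟨y, hy, h2⟩ := hu'
        have hxy : x ≠ y := by rintro rfl; exact hu h2
        have h3 := hr2 y hy hxy
        have h4 := l2Dist_triangle x (fun i => (colorCount σ i : ℝ) / n) y
        have h5 := l2Dist_triangle (fun i => (colorCount σ i : ℝ) / n) u y
        rw [l2Dist_comm x fun i => (colorCount σ i : ℝ) / n] at h4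
        rw [l2Dist_comm _ u] at h5
        linarith)
    have := mul_le_mul_of_nonneg_left key hs
    simp only [hT, integral_exp_scale, ha, η, setIntegral_univ]
    rw [← mul_sub, abs_mul, abs_of_nonneg hs]
    refine this.trans (le_of_eq ?_)
    ring
  have hTx : Tendsto (fun n => T n (V x)) atTop (𝓝 (κ * tauWeight q β lam nu x)) := hr1 x hx
  have hdiff : Tendsto (fun n => a n - T n (V x)) atTop (𝓝 0) := by
    refine squeeze_zero_norm' hbound ?_
    have := (hη.mul hTuniv).add hTO
    rwa [zero_mul, zero_add] at this
  have hlim := hdiff.add hTx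
  simp only [sub_add_cancel, zero_add] at hlim
  have hpos : 0 < ∑ y ∈ hfin.toFinset, tauWeight q β lam nu y :=
    Finset.sum_pos (fun y hy => (hloc y (by simpa using hy)).1) ⟨x, by simpa using hx⟩
  have hfinal := hlim.div hTuniv (mul_pos hκ hpos).ne'
  rw [mul_div_mul_left _ _ hκ.ne'] at hfinal
  refine hfinal.congr' ?_
  filter_upwards [hgood] with n hn
  have hs : √(n : ℝ) ^ q * Real.exp (n * m) ≠ 0 := by
    have := hn.1
    positivity
  rw [cwProb_eq_div hn.1 hn.2]
  simp only [Pi.div_apply, hT, integral_exp_scale, ha, setIntegral_univ]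
  rw [mul_div_mul_left _ _ hs]

end Coexistence

/-- coexistence probabilities: when `(β_n,h_n) = (β,h) + n⁻¹(λ,ν) + o(n⁻¹)`
and `f_{β,h}` has multiple global minimizers, the probability that `N/n` lies within
`ε` of a given global minimizer `x` converges to `τ(x)/∑ τ(x')` (sum over all global
minimizers). -/
theorem stmt_15 (q : ℕ) [NeZero q] (hq : 2 ≤ q) (β h : ℝ) (hβ : 0 ≤ β) (hh : 0 ≤ h)
    (lam nu : ℝ) (βseq hseq : ℕ → ℝ)
    (hβs : Tendsto (fun n : ℕ => (n : ℝ) * (βseq n - β)) atTop (𝓝 lam))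
    (hhs : Tendsto (fun n : ℕ => (n : ℝ) * (hseq n - h)) atTop (𝓝 nu))
    (x : Fin q → ℝ) (hx : x ∈ simplex q)
    (hmin : ∀ y ∈ simplex q, freeEnergy q β h x ≤ freeEnergy q β h y)
    (hmult : ∃ x' ∈ simplex q, x' ≠ x ∧
      ∀ y ∈ simplex q, freeEnergy q β h x' ≤ freeEnergy q β h y)
    (hfin : {y | y ∈ simplex q ∧
      ∀ z ∈ simplex q, freeEnergy q β h y ≤ freeEnergy q β h z}.Finite)
    (ε : ℝ) (hε : 0 < ε)
    (hεsmall : ∀ y ∈ simplex q, ∀ y' ∈ simplex q,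
      (∀ z ∈ simplex q, freeEnergy q β h y ≤ freeEnergy q β h z) →
      (∀ z ∈ simplex q, freeEnergy q β h y' ≤ freeEnergy q β h z) →
      y ≠ y' → ε < Real.sqrt (∑ i, (y i - y' i) ^ 2)) :
    Tendsto (fun n : ℕ => cwProb q n (βseq n) (hseq n)
        {σ | Real.sqrt (∑ i, ((colorCount σ i : ℝ) / n - x i) ^ 2) < ε})
      atTop
      (𝓝 (tauWeight q β lam nu x /
        ∑ᶠ y ∈ {y | y ∈ simplex q ∧
          ∀ z ∈ simplex q, freeEnergy q β h y ≤ freeEnergy q β h z},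
            tauWeight q β lam nu y)) := by
  have hx' : x ∈ minimizers q β h := ⟨hx, hmin⟩
  obtain ⟨x', hx's, hne, hx'm⟩ := hmult
  have hxx' : x' ∈ minimizers q β h := ⟨hx's, hx'm⟩
  have hfin' : (minimizers q β h).Finite := hfin
  have hsum : ∑ᶠ y ∈ minimizers q β h, tauWeight q β lam nu y =
      ∑ y ∈ hfin'.toFinset, tauWeight q β lam nu y :=
    finsum_mem_eq_finite_toFinset_sum _ hfin'
  have key := tendsto_cwProb_coexistence hq (beta_pos_of_multiple hβ hxx' hx' hne) hh hβs hhs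
    hx' hxx' hne hfin' hε fun y hy y' hy' => hεsmall y hy.1 y' hy'.1 hy.2 hy'.2
  rw [← hsum] at key
  exact key
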